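/- arXiv:1807.08648 — 9 statements merged into one kernel-verified Lean document; each statement's English description precedes it below -/
import Mathlib

section
/- Let Q be a nonempty Schröder word, and write Q = F_1 F_2 ⋯ F_k for its unique factorization into irreducible Schröder factors (each F_i is a nonempty Schröder word whose proper nonempty prefixes all have strictly more U's than D's). For each i let a_i be the number of ascents of F_i (maximal runs of consecutive U's) and d_i the number of descents of F_i (maximal runs of consecutive D's). Let p(Q) be the number of occurrences of UDU as a contiguous factor of Q, v(Q) the number of occurrences of DUD as a contiguous factor of Q, and h(Q) the number of flats of Q (maximal runs of consecutive H's). Then the number of Schröder words P with P ≤ Q and semilength(P) = semilength(Q) − 1 equals (Σ_{1 ≤ i ≤ j ≤ k} d_i·a_j) − p(Q) − v(Q) + h(Q). -/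
/-- Steps of a Schröder path: `U` = (1,1), `D` = (1,-1), `H` = (2,0). -/
inductive Step : Type
  | U : Step
  | D : Step
  | H : Step
  deriving DecidableEq

/-- Number of `U` steps of a word. -/
def countU (w : List Step) : ℕ := w.count Step.U

/-- Number of `D` steps of a word. -/
def countD (w : List Step) : ℕ := w.count Step.D

/-- Number of `H` steps of a word. -/
def countH (w : List Step) : ℕ := w.count Step.H

/-- A word is a Schröder word if every prefix has at least as many `U`'s as `D`'s
and the whole word has equally many `U`'s and `D`'s. -/
def IsSchroder (w : List Step) : Prop :=
  (∀ p : List Step, p <+: w → countD p ≤ countU p) ∧ countU w = countD w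

/-- The semilength of a Schröder word. -/
def semilength (w : List Step) : ℕ := countU w + countH w

/-- An irreducible Schröder factor: a nonempty Schröder word all of whose proper
nonempty prefixes have strictly more `U`'s than `D`'s. -/
def IsIrreducibleFactor (w : List Step) : Prop :=
  w ≠ [] ∧ IsSchroder w ∧
    ∀ p : List Step, p <+: w → p ≠ [] → p ≠ w → countD p < countU p

/-- The number of maximal runs of consecutive letters `s` in a word
(for `s = U` these are the ascents, for `s = D` the descents, for `s = H` the flats). -/
def runs (s : Step) : List Step → ℕ
  | [] => 0
  | a :: rest => (if a = s ∧ rest.head? ≠ some s then 1 else 0) + runs s rest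

/-- The number of occurrences of `pat` as a contiguous factor of a word. -/
def occ (pat : List Step) : List Step → ℕ
  | [] => 0
  | a :: rest => (if pat <+: (a :: rest) then 1 else 0) + occ pat rest

open Step

/-- `V w h`: the path `w` started at height `h` stays nonnegative and ends at height `0`. -/
def V : List Step → ℕ → Prop
  | [], h => h = 0
  | U :: Q, h => V Q (h + 1)
  | D :: _, 0 => False
  | D :: Q, h + 1 => V Q h
  | H :: Q, h => V Q h

/-- `I w h`: the path `w` started at height `h` reaches height `0` exactly at its end. -/
def I : List Step → ℕ → Prop
  | [], h => h = 0
  | _ :: _, 0 => False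
  | U :: Q, h + 1 => I Q (h + 2)
  | D :: Q, h + 1 => I Q h
  | H :: Q, h + 1 => I Q (h + 1)

/-- Words obtained by deleting one letter `s`. -/
def del (s : Step) : List Step → Finset (List Step)
  | [] => ∅
  | a :: Q => (del s Q).image (List.cons a) ∪ (if a = s then {Q} else ∅)

/-- Words obtained by deleting one `D` at or before the first return to `0` from `h + 1`. -/
def delD : List Step → ℕ → Finset (List Step)
  | [], _ => ∅
  | U :: Q, h => (delD Q (h + 1)).image (List.cons U)
  | H :: Q, h => (delD Q h).image (List.cons H)
  | D :: Q, 0 => {Q}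
  | D :: Q, h + 1 => (delD Q h).image (List.cons D) ∪ {Q}

/-- Words obtained by admissibly deleting one `U` and one `D`. -/
def delP : List Step → ℕ → Finset (List Step)
  | [], _ => ∅
  | U :: Q, h => (delP Q (h + 1)).image (List.cons U) ∪ delD Q h
  | H :: Q, h => (delP Q h).image (List.cons H)
  | D :: Q, 0 => ∅
  | D :: Q, h + 1 => (delP Q h).image (List.cons D) ∪ del U Q

/-- Number of `D`-runs up to the first return to `0` from `h + 1`. -/
def numD : List Step → ℕ → ℕ
  | [], _ => 0
  | U :: Q, h => numD Q (h + 1)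
  | H :: Q, h => numD Q h
  | D :: Q, 0 => if Q.head? = some D then 0 else 1
  | D :: Q, h + 1 => numD Q h + if Q.head? = some D then 0 else 1

/-- Number of admissible pairs of runs. -/
def numP : List Step → ℕ → ℕ
  | [], _ => 0
  | U :: Q, h => numP Q (h + 1) + if Q.head? = some U then 0 else numD Q h
  | H :: Q, h => numP Q h
  | D :: _, 0 => 0
  | D :: Q, h + 1 => numP Q h + if Q.head? = some D then 0 else runs U Q

theorem V_iff (w : List Step) (h : ℕ) :
    V w h ↔ (∀ p : List Step, p <+: w → countD p ≤ h + countU p) ∧ h + countU w = countD w := by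
  induction w generalizing h with
  | nil => simp [V, countU, countD]
  | cons a w ih =>
    have key : (∀ p : List Step, p <+: a :: w → countD p ≤ h + countU p) ↔
        ∀ p : List Step, p <+: w → countD (a :: p) ≤ h + countU (a :: p) := by
      constructor
      · intro H p hp
        exact H _ (by simpa using hp)
      · intro H p hp
        cases p with
        | nil => simp [countD]
        | cons b p =>
          obtain ⟨rfl, hp⟩ := List.cons_prefix_cons.1 hp
          exact H p (by assumption)
    rw [key]
    cases a with
    | U => 
      simp only [V, ih, countU, countD]
      simp [add_assoc, add_comm 1]
    | H => 
      simp only [V, ih, countU, countD]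
      simp
    | D =>
      cases h with
      | zero => 
        simp only [V, false_iff]
        rintro ⟨h1, -⟩
        have := h1 [] (by simp)
        simp [countU, countD] at this
      | succ h =>
        simp only [V, ih, countU, countD]
        simp [add_right_comm]

theorem isSchroder_iff (w : List Step) : IsSchroder w ↔ V w 0 := by
  rw [V_iff]; simp [IsSchroder]

theorem I_of (w : List Step) (h : ℕ)
    (h1 : ∀ p : List Step, p <+: w → p ≠ w → countD p < h + countU p)
    (h2 : h + countU w = countD w) : I w h := by
  induction w generalizing h with
  | nil => simpa [I, countU, countD] using h2
  | cons a w ih =>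
    have h0 := h1 [] (by simp) (by simp)
    obtain ⟨h, rfl⟩ : ∃ k, h = k + 1 := ⟨h - 1, by simp [countD, countU] at h0; omega⟩
    have key : ∀ p : List Step, p <+: w → p ≠ w → countD (a :: p) < h + 1 + countU (a :: p) := by
      intro p hp hne
      exact h1 _ (by simpa using hp) (by simpa using hne)
    cases a with
    | U =>
      apply ih
      · intro p hp hne
        have := key p hp hne
        simp [countU, countD] at *; omega
      · simp [countU, countD] at *; omega
    | H =>
      apply ih
      · intro p hp hne
        have := key p hp hne
        simp [countU, countD] at *; omega
      · simp [countU, countD] at *; omega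
    | D =>
      apply ih
      · intro p hp hne
        have := key p hp hne
        simp [countU, countD] at *; omega
      · simp [countU, countD] at *; omega

theorem irr_cases (f : List Step) (hf : IsIrreducibleFactor f) :
    f = [H] ∨ ∃ g, f = U :: g ∧ I g 1 := by
  obtain ⟨hne, ⟨hs, hb⟩, hp⟩ := hf
  cases f with
  | nil => simp at hne
  | cons a g =>
    cases a with
    | U =>
      refine Or.inr ⟨g, rfl, I_of _ _ ?_ ?_⟩
      · intro p hpg hpne
        have := hp (U :: p) (by simpa using hpg) (by simp) (by simpa using hpne)
        simp [countU, countD] at *; omega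
      · simp [countU, countD] at *; omega
    | D =>
      have := hs [D] (by simp)
      simp [countU, countD] at this
    | H =>
      left
      by_contra hg
      have := hp [H] (by simp) (by simp) (fun h => hg h.symm)
      simp [countU, countD] at this

theorem mem_del (s : Step) (Q P : List Step) :
    P ∈ del s Q ↔ P.Sublist Q ∧ ∀ t, P.count t + (if t = s then 1 else 0) = Q.count t := by
  induction Q generalizing P with
  | nil =>
    simp only [del, Finset.notMem_empty, false_iff]
    rintro ⟨-, h⟩
    have := h s
    simp at this
  | cons a Q ih =>
    simp only [del, Finset.mem_union, Finset.mem_image, ih]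
    constructor
    · rintro (⟨P', ⟨h1, h2⟩, rfl⟩ | h)
      · refine ⟨by simpa using h1, fun t => ?_⟩
        simp only [List.count_cons, ← h2 t]; omega
      · split_ifs at h with has
        · simp at h; subst h; subst has
          refine ⟨by simp, fun t => ?_⟩
          simp only [List.count_cons]
          congr 1
          by_cases h : t = a
          · simp [h]
          · have h' : ¬ a = t := fun e => h e.symm
            simp [h, h']
        · simp at h
    · rintro ⟨h1, h2⟩
      rw [List.sublist_cons_iff] at h1
      rcases h1 with h1 | ⟨P', rfl, h1⟩
      · right
        have hle : P.count a ≤ Q.count a := h1.count_le a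
        have ha := h2 a
        have has : a = s := by
          by_contra hh
          simp [hh] at ha; omega
        subst has
        simp only [if_true, Finset.mem_singleton]
        refine h1.eq_of_length_le ?_
        have hperm : Q.Perm P := by
          rw [List.perm_iff_count]
          intro t
          have := h2 t
          by_cases hh : t = a
          · subst hh; simp at this; omega
          · have h3 : ¬ a = t := fun h => hh h.symm
            simp [hh, List.count_cons, h3] at this; omega
        exact hperm.length_eq.le
      · left
        refine ⟨P', ⟨h1, fun t => ?_⟩, rfl⟩
        have := h2 t
        simp only [List.count_cons] at this; omega

theorem eq_of_counts {P Q : List Step} (h : P.Sublist Q) (hU : P.count U = Q.count U)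
    (hD : P.count D = Q.count D) (hH : P.count H = Q.count H) : P = Q := by
  refine h.eq_of_length_le ?_
  have hperm : Q.Perm P := by
    rw [List.perm_iff_count]
    intro t
    cases t <;> omega
  exact hperm.length_eq.le

theorem V_of_delU (Q P : List Step) (h : ℕ) (hV : V Q h) (hP : P ∈ del U Q) : V P (h + 1) := by
  induction Q generalizing P h with
  | nil => simp [del] at hP
  | cons a Q ih =>
    simp only [del, Finset.mem_union, Finset.mem_image] at hP
    rcases hP with ⟨P', h1, rfl⟩ | hP
    · cases a with
      | U => exact ih P' (h + 1) hV h1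
      | H => exact ih P' h hV h1
      | D =>
        cases h with
        | zero => exact hV.elim
        | succ h => exact ih P' h hV h1
    · cases a <;> simp at hP
      subst hP
      exact hV

theorem V_of_delH (Q P : List Step) (h : ℕ) (hV : V Q h) (hP : P ∈ del H Q) : V P h := by
  induction Q generalizing P h with
  | nil => simp [del] at hP
  | cons a Q ih =>
    simp only [del, Finset.mem_union, Finset.mem_image] at hP
    rcases hP with ⟨P', h1, rfl⟩ | hP
    · cases a with
      | U => exact ih P' (h + 1) hV h1
      | H => exact ih P' h hV h1
      | D =>
        cases h with
        | zero => exact hV.elim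
        | succ h => exact ih P' h hV h1
    · cases a <;> simp at hP
      subst hP
      exact hV

theorem mem_delD (Q P : List Step) (h : ℕ) (hV : V Q (h + 1)) :
    P ∈ delD Q h ↔ V P h ∧ P.Sublist Q ∧ P.count U = Q.count U ∧
      P.count D + 1 = Q.count D ∧ P.count H = Q.count H := by
  induction Q generalizing P h with
  | nil => simp [V] at hV
  | cons a Q ih =>
    cases a with
    | U =>
      simp only [delD, Finset.mem_image, ih _ (h + 1) hV]
      constructor
      · rintro ⟨P', ⟨h1, h2, h3, h4, h5⟩, rfl⟩
        exact ⟨h1, by simpa using h2, by simpa using h3, by simpa using h4, by simpa using h5⟩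
      · rintro ⟨h1, h2, h3, h4, h5⟩
        rw [List.sublist_cons_iff] at h2
        rcases h2 with h2 | ⟨P', rfl, h2⟩
        · have := h2.count_le U
          simp at h3; omega
        · exact ⟨P', ⟨h1, h2, by simpa using h3, by simpa using h4, by simpa using h5⟩, rfl⟩
    | H =>
      simp only [delD, Finset.mem_image, ih _ h hV]
      constructor
      · rintro ⟨P', ⟨h1, h2, h3, h4, h5⟩, rfl⟩
        exact ⟨h1, by simpa using h2, by simpa using h3, by simpa using h4, by simpa using h5⟩
      · rintro ⟨h1, h2, h3, h4, h5⟩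
        rw [List.sublist_cons_iff] at h2
        rcases h2 with h2 | ⟨P', rfl, h2⟩
        · have := h2.count_le H
          simp at h5; omega
        · exact ⟨P', ⟨h1, h2, by simpa using h3, by simpa using h4, by simpa using h5⟩, rfl⟩
    | D =>
      have hQ : V Q h := hV
      have hmain : P.Sublist Q → P.count U = (D :: Q).count U →
          P.count D + 1 = (D :: Q).count D → P.count H = (D :: Q).count H → P = Q := by
        intro h2 h3 h4 h5
        exact eq_of_counts h2 (by simpa using h3) (by simpa using h4) (by simpa using h5)
      cases h with
      | zero =>
        simp only [delD, Finset.mem_singleton]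
        constructor
        · rintro rfl
          exact ⟨hQ, by simp, by simp, by simp, by simp⟩
        · rintro ⟨h1, h2, h3, h4, h5⟩
          rw [List.sublist_cons_iff] at h2
          rcases h2 with h2 | ⟨P', rfl, h2⟩
          · exact hmain h2 h3 h4 h5
          · exact h1.elim
      | succ h =>
        simp only [delD, Finset.mem_union, Finset.mem_singleton, Finset.mem_image, ih _ h hQ]
        constructor
        · rintro (⟨P', ⟨h1, h2, h3, h4, h5⟩, rfl⟩ | rfl)
          · exact ⟨h1, by simpa using h2, by simpa using h3, by simpa using h4, by simpa using h5⟩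
          · exact ⟨hQ, by simp, by simp, by simp, by simp⟩
        · rintro ⟨h1, h2, h3, h4, h5⟩
          rw [List.sublist_cons_iff] at h2
          rcases h2 with h2 | ⟨P', rfl, h2⟩
          · exact Or.inr (hmain h2 h3 h4 h5)
          · exact Or.inl ⟨P', ⟨h1, h2, by simpa using h3, by simpa using h4, by simpa using h5⟩, rfl⟩

theorem mem_delP (Q P : List Step) (h : ℕ) (hV : V Q h) :
    P ∈ delP Q h ↔ V P h ∧ P.Sublist Q ∧ P.count U + 1 = Q.count U ∧
      P.count D + 1 = Q.count D ∧ P.count H = Q.count H := by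
  induction Q generalizing P h with
  | nil => simp [delP]
  | cons a Q ih =>
    cases a with
    | U =>
      simp only [delP, Finset.mem_union, Finset.mem_image, ih _ (h + 1) hV, mem_delD Q P h hV]
      constructor
      · rintro (⟨P', ⟨h1, h2, h3, h4, h5⟩, rfl⟩ | ⟨h1, h2, h3, h4, h5⟩)
        · exact ⟨h1, by simpa using h2, by simpa using h3, by simpa using h4, by simpa using h5⟩
        · exact ⟨h1, h2.cons _, by simpa using h3, by simpa using h4, by simpa using h5⟩
      · rintro ⟨h1, h2, h3, h4, h5⟩
        rw [List.sublist_cons_iff] at h2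
        rcases h2 with h2 | ⟨P', rfl, h2⟩
        · exact Or.inr ⟨h1, h2, by simpa using h3, by simpa using h4, by simpa using h5⟩
        · exact Or.inl ⟨P', ⟨h1, h2, by simpa using h3, by simpa using h4, by simpa using h5⟩, rfl⟩
    | H =>
      simp only [delP, Finset.mem_image, ih _ h hV]
      constructor
      · rintro ⟨P', ⟨h1, h2, h3, h4, h5⟩, rfl⟩
        exact ⟨h1, by simpa using h2, by simpa using h3, by simpa using h4, by simpa using h5⟩
      · rintro ⟨h1, h2, h3, h4, h5⟩
        rw [List.sublist_cons_iff] at h2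
        rcases h2 with h2 | ⟨P', rfl, h2⟩
        · have := h2.count_le H
          simp at h5; omega
        · exact ⟨P', ⟨h1, h2, by simpa using h3, by simpa using h4, by simpa using h5⟩, rfl⟩
    | D =>
      cases h with
      | zero => exact hV.elim
      | succ h =>
        have hQ : V Q h := hV
        simp only [delP, Finset.mem_union, Finset.mem_image, ih _ h hQ]
        constructor
        · rintro (⟨P', ⟨h1, h2, h3, h4, h5⟩, rfl⟩ | hP)
          · exact ⟨h1, by simpa using h2, by simpa using h3, by simpa using h4, by simpa using h5⟩
          · have hv := V_of_delU Q P h hQ hP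
            obtain ⟨h2, h3⟩ := (mem_del _ _ _).1 hP
            have hu := h3 U
            have hd := h3 D
            have hh := h3 H
            simp at hu hd hh
            exact ⟨hv, h2.cons _, by simpa using hu, by simpa using hd, by simpa using hh⟩
        · rintro ⟨h1, h2, h3, h4, h5⟩
          rw [List.sublist_cons_iff] at h2
          rcases h2 with h2 | ⟨P', rfl, h2⟩
          · right
            simp at h3 h4 h5
            rw [mem_del]
            refine ⟨h2, fun t => ?_⟩
            cases t <;> simp [*]
          · exact Or.inl ⟨P', ⟨h1, h2, by simpa using h3, by simpa using h4, by simpa using h5⟩, rfl⟩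

theorem card_image_cons (a : Step) (S : Finset (List Step)) :
    (S.image (List.cons a)).card = S.card :=
  Finset.card_image_of_injective _ List.cons_injective

theorem card_del (s : Step) (Q : List Step) : (del s Q).card = runs s Q := by
  induction Q with
  | nil => simp [del, runs]
  | cons a Q ih =>
    simp only [del, runs]
    by_cases has : a = s
    · subst has
      by_cases hh : Q.head? = some a
      · obtain ⟨Q', rfl⟩ : ∃ Q', Q = a :: Q' := by
          cases Q with
          | nil => simp at hh
          | cons b Q => simp at hh; exact ⟨Q, by rw [hh]⟩
        have : (a :: Q') ∈ (del a (a :: Q')).image (List.cons a) :=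
          Finset.mem_image_of_mem _ (by simp [del])
        rw [if_pos rfl, Finset.union_eq_left.2 (by simpa using this), card_image_cons, ih]
        simp
      · rw [if_pos rfl, Finset.card_union_of_disjoint, card_image_cons, ih]
        · simp [hh, add_comm]
        · rw [Finset.disjoint_singleton_right, Finset.mem_image]
          rintro ⟨P, -, rfl⟩
          simp at hh
    · simp [has, card_image_cons, ih]

theorem card_delD (Q : List Step) (h : ℕ) (hV : V Q (h + 1)) :
    (delD Q h).card = numD Q h := by
  induction Q generalizing h with
  | nil => simp [delD, numD]
  | cons a Q ih =>
    cases a with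
    | U => simpa [delD, numD, card_image_cons] using ih (h + 1) hV
    | H => simpa [delD, numD, card_image_cons] using ih h hV
    | D =>
      have hQ : V Q h := hV
      cases h with
      | zero =>
        have hh : Q.head? ≠ some D := by
          intro hh
          cases Q with
          | nil => simp at hh
          | cons b Q => simp at hh; subst hh; exact hQ
        simp [delD, numD, hh]
      | succ h =>
        simp only [delD, numD]
        by_cases hh : Q.head? = some D
        · obtain ⟨Q', rfl⟩ : ∃ Q', Q = D :: Q' := by
            cases Q with
            | nil => simp at hh
            | cons b Q => simp at hh; exact ⟨Q, by rw [hh]⟩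
          have : (D :: Q') ∈ (delD (D :: Q') h).image (List.cons D) :=
            Finset.mem_image_of_mem _ (by cases h <;> simp [delD])
          rw [Finset.union_eq_left.2 (by simpa using this), card_image_cons, ih h hQ]
          simp
        · rw [Finset.card_union_of_disjoint, card_image_cons, ih h hQ]
          · simp [hh]
          · rw [Finset.disjoint_singleton_right, Finset.mem_image]
            rintro ⟨P, -, rfl⟩
            simp at hh

/-- Union with a set whose `a`-initial members are already present. -/
theorem card_union_cons (a : Step) (S T : Finset (List Step))
    (hT : ∀ P, a :: P ∈ T → P ∈ S) :
    (S.image (List.cons a) ∪ T).card = S.card + (T.filter (fun P => P.head? ≠ some a)).card := by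
  rw [← card_image_cons a S, ← Finset.card_union_of_disjoint]
  · congr 1
    ext P
    simp only [Finset.mem_union, Finset.mem_filter]
    constructor
    · rintro (h | h)
      · exact Or.inl h
      · by_cases hh : P.head? = some a
        · cases P with
          | nil => simp at hh
          | cons b P =>
            simp at hh; subst hh
            exact Or.inl (Finset.mem_image_of_mem _ (hT _ h))
        · exact Or.inr ⟨h, hh⟩
    · rintro (h | h)
      · exact Or.inl h
      · exact Or.inr h.1
  · rw [Finset.disjoint_left]
    intro P hP hP2
    obtain ⟨P', -, rfl⟩ := Finset.mem_image.1 hP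
    simp at hP2

theorem filter_image_same (a : Step) (S : Finset (List Step)) :
    (S.image (List.cons a)).filter (fun P => P.head? ≠ some a) = ∅ := by
  ext P; simp; rintro P' - rfl; simp

theorem filter_image_ne (a b : Step) (hab : a ≠ b) (S : Finset (List Step)) :
    (S.image (List.cons a)).filter (fun P => P.head? ≠ some b) = S.image (List.cons a) := by
  ext P; simp; rintro P' - rfl; simpa using hab

theorem head_cases (Q : List Step) : Q = [] ∨ ∃ a Q', Q = a :: Q' := by
  cases Q <;> simp

theorem filter_delD (Q : List Step) (h : ℕ) (hV : V Q (h + 1)) :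
    ((delD Q h).filter (fun P => P.head? ≠ some U)).card +
      (if [D, U] <+: Q then 1 else 0) = if Q.head? = some U then 0 else numD Q h := by
  cases Q with
  | nil => simp [V] at hV
  | cons a Q =>
    cases a with
    | U => 
      simp only [delD]
      rw [filter_image_same]; simp
    | H =>
      rw [← card_delD _ _ hV]
      simp only [delD]
      rw [filter_image_ne _ _ (by simp)]; simp
    | D =>
      rw [← card_delD _ _ hV]
      have hQ : V Q h := hV
      have hpre : ([D, U] <+: D :: Q) ↔ Q.head? = some U := by
        cases Q <;> simp [List.cons_prefix_cons, eq_comm]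
      simp only [hpre]
      cases h with
      | zero =>
        by_cases hh : Q.head? = some U <;> simp [delD, hh, Finset.filter_singleton]
      | succ h =>
        simp only [delD]
        rw [Finset.filter_union, filter_image_ne _ _ (by simp)]
        by_cases hh : Q.head? = some U
        · rw [Finset.card_union_of_disjoint (s := Finset.image _ _) (t := {Q})]
          · simp [hh, Finset.filter_singleton]
          · rw [Finset.disjoint_singleton_right, Finset.mem_image]
            rintro ⟨P, -, rfl⟩
            simp at hh
        · simp [hh, Finset.filter_singleton]

theorem filter_delU (Q : List Step) :
    ((del U Q).filter (fun P => P.head? ≠ some D)).card +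
      (if [U, D] <+: Q then 1 else 0) = if Q.head? = some D then 0 else runs U Q := by
  cases Q with
  | nil => simp [del, runs]
  | cons a Q =>
    rw [← card_del]
    cases a with
    | D => 
      simp only [del]
      rw [Finset.filter_union, filter_image_same]; simp
    | H =>
      simp only [del]
      rw [Finset.filter_union, filter_image_ne _ _ (by simp)]; simp
    | U =>
      have hpre : ([U, D] <+: U :: Q) ↔ Q.head? = some D := by
        cases Q <;> simp [List.cons_prefix_cons, eq_comm]
      simp only [hpre]
      simp only [del, if_true]
      rw [Finset.filter_union, filter_image_ne _ _ (by simp)]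
      by_cases hh : Q.head? = some D
      · rw [Finset.card_union_of_disjoint (s := Finset.image _ _) (t := {Q})]
        · simp [hh, Finset.filter_singleton]
        · rw [Finset.disjoint_singleton_right, Finset.mem_image]
          rintro ⟨P, -, rfl⟩
          simp at hh
      · simp [hh, Finset.filter_singleton]

theorem card_delP (Q : List Step) (h : ℕ) (hV : V Q h) :
    (delP Q h).card + occ [U, D, U] Q + occ [D, U, D] Q = numP Q h := by
  induction Q generalizing h with
  | nil => simp [delP, numP, occ]
  | cons a Q ih =>
    cases a with
    | U =>
      have hQ : V Q (h + 1) := hV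
      have h1 := ih _ hQ
      have h2 := filter_delD Q h hQ
      have h3 := card_union_cons U (delP Q (h + 1)) (delD Q h) (by
        intro P hP
        rw [mem_delD _ _ _ hQ] at hP
        rw [mem_delP _ _ _ hQ]
        obtain ⟨p1, p2, p3, p4, p5⟩ := hP
        exact ⟨p1, (List.sublist_cons_self _ _).trans p2, by simpa using p3, by simpa using p4,
          by simpa using p5⟩)
      simp only [delP, numP, occ]
      rw [h3]
      simp only [List.cons_prefix_cons, true_and, reduceCtorEq, false_and, if_false]
      omega
    | H =>
      have h1 := ih _ (show V Q h from hV)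
      simp [delP, numP, occ, card_image_cons, List.cons_prefix_cons, h1]
    | D =>
      cases h with
      | zero => exact hV.elim
      | succ h =>
        have hQ : V Q h := hV
        have h1 := ih _ hQ
        have h2 := filter_delU Q
        have h3 := card_union_cons D (delP Q h) (del U Q) (by
          intro P hP
          have hv := V_of_delU _ _ _ hQ hP
          rw [mem_del] at hP
          rw [mem_delP _ _ _ hQ]
          obtain ⟨p2, p3⟩ := hP
          have hu := p3 U
          have hd := p3 D
          have hh := p3 H
          simp at hu hd hh
          exact ⟨hv, (List.sublist_cons_self _ _).trans p2, hu, hd, hh⟩)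
        simp only [delP, numP, occ]
        rw [h3]
        simp only [List.cons_prefix_cons, true_and, reduceCtorEq, false_and, if_false]
        omega

theorem runs_cons (s a : Step) (Q : List Step) :
    runs s (a :: Q) = (if a = s ∧ Q.head? ≠ some s then 1 else 0) + runs s Q := rfl

theorem runsU_append (f r : List Step) (h : ℕ) (hf : I f h) :
    runs U (f ++ r) = runs U f + runs U r := by
  induction f generalizing h with
  | nil => simp [runs]
  | cons a f ih =>
    cases h with
    | zero => exact hf.elim
    | succ h =>
      have h1 : runs U (f ++ r) = runs U f + runs U r := by
        cases a <;> exact ih _ hf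
      simp only [List.cons_append, runs, h1]
      cases f with
      | nil => cases a <;> simp [I] at hf ⊢
      | cons b f => simp [add_assoc]

theorem numD_append (f r : List Step) (h : ℕ) (hf : I f (h + 1)) (hr : r.head? ≠ some D) :
    numD (f ++ r) h = runs D f := by
  induction f generalizing h with
  | nil => simp [I] at hf
  | cons a f ih =>
    cases a with
    | U => simpa [numD, runs] using ih _ hf
    | H => simpa [numD, runs] using ih _ hf
    | D =>
      cases h with
      | zero =>
        cases f with
        | nil => simp [numD, runs, hr]
        | cons b f => exact (show False from hf).elim
      | succ h =>
        have h1 := ih _ hf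
        cases f with
        | nil => simp [I] at hf
        | cons b f =>
          simp only [List.cons_append, numD, runs] at h1 ⊢
          rw [h1]
          by_cases hb : b = D <;> simp [hb] <;> omega

theorem numP_append (f r : List Step) (h : ℕ) (hf : I f h) (hr : r.head? ≠ some D) :
    numP (f ++ r) h = runs D f * (runs U f + runs U r) + numP r 0 := by
  induction f generalizing h with
  | nil => simp [I] at hf; simp [runs, hf]
  | cons a f ih =>
    cases h with
    | zero => exact hf.elim
    | succ h =>
      cases a with
      | U =>
        have hf' : I f (h + 2) := hf
        have h1 := ih _ hf'
        have h2 := numD_append f r (h + 1) hf' hr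
        cases f with
        | nil => simp [I] at hf'
        | cons b f =>
          simp only [List.cons_append] at h1 h2 ⊢
          rw [numP, h1, h2, runs_cons D U, runs_cons U U]
          by_cases hb : b = U <;> simp [hb] <;> ring
      | H =>
        have h1 := ih _ hf
        simp only [List.cons_append, numP, h1]
        simp [runs]
      | D =>
        have hf' : I f h := hf
        have h1 := ih _ hf'
        have h2 := runsU_append f r _ hf'
        simp only [List.cons_append, numP, h1, h2]
        rw [runs, runs]
        cases f with
        | nil => simp [runs, hr]; ring
        | cons b f => by_cases hb : b = D <;> simp [hb] <;> ring

theorem irr_head (F : List (List Step)) (hirr : ∀ f ∈ F, IsIrreducibleFactor f) :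
    F.flatten.head? ≠ some D := by
  cases F with
  | nil => simp
  | cons f F =>
    rcases irr_cases f (hirr f (by simp)) with rfl | ⟨g, rfl, -⟩ <;> simp

theorem factor_step (f r : List Step) (hf : IsIrreducibleFactor f) (hr : r.head? ≠ some D) :
    numP (f ++ r) 0 = runs D f * (runs U f + runs U r) + numP r 0 ∧
    runs U (f ++ r) = runs U f + runs U r := by
  rcases irr_cases f hf with rfl | ⟨g, rfl, hg⟩
  · simp [numP, runs]
  · have h1 := numP_append g r 1 hg hr
    have h2 := numD_append g r 0 hg hr
    have h3 := runsU_append g r 1 hg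
    cases g with
    | nil => simp [I] at hg
    | cons b g =>
      simp only [List.cons_append] at h1 h2 h3 ⊢
      rw [numP, h1, h2, runs_cons U U (b :: (g ++ r)), h3, runs_cons D U, runs_cons U U]
      by_cases hb : b = U <;> simp [hb] <;> (try constructor) <;> ring

theorem runsU_sum (F : List (List Step)) (hirr : ∀ f ∈ F, IsIrreducibleFactor f) :
    (runs U F.flatten : ℤ) = ∑ j ∈ Finset.range F.length, (runs U (F.getD j []) : ℤ) := by
  induction F with
  | nil => simp [runs]
  | cons f F ih =>
    have hF : ∀ f ∈ F, IsIrreducibleFactor f := fun g hg => hirr g (by simp [hg])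
    have h1 := (factor_step f F.flatten (hirr f (by simp)) (irr_head F hF)).2
    rw [List.flatten_cons, h1, List.length_cons, Finset.sum_range_succ']
    push_cast
    rw [ih hF]
    simp [add_comm]

theorem numP_sum (F : List (List Step)) (hirr : ∀ f ∈ F, IsIrreducibleFactor f) :
    (numP F.flatten 0 : ℤ) = ∑ i ∈ Finset.range F.length, ∑ j ∈ Finset.range F.length,
        if i ≤ j then (runs D (F.getD i []) : ℤ) * (runs U (F.getD j []) : ℤ) else 0 := by
  induction F with
  | nil => simp [numP]
  | cons f F ih =>
    have hF : ∀ f ∈ F, IsIrreducibleFactor f := fun g hg => hirr g (by simp [hg])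
    have h1 := (factor_step f F.flatten (hirr f (by simp)) (irr_head F hF)).1
    rw [List.flatten_cons, h1, List.length_cons, Finset.sum_range_succ']
    simp only [Finset.sum_range_succ']
    push_cast
    rw [ih hF, runsU_sum F hF]
    simp [Finset.mul_sum, mul_add]
    ring

theorem V_counts {w : List Step} (h : V w 0) : w.count U = w.count D := by
  have := ((V_iff w 0).1 h).2
  simpa [countU, countD] using this

theorem schroder_covered_count (Q : List Step) (F : List (List Step))
    (hQ : IsSchroder Q) (hne : Q ≠ [])
    (hfact : Q = F.flatten)
    (hirr : ∀ f ∈ F, IsIrreducibleFactor f) :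
    (Nat.card {P : List Step // IsSchroder P ∧ P.Sublist Q ∧
        semilength P = semilength Q - 1} : ℤ) =
      (∑ i ∈ Finset.range F.length, ∑ j ∈ Finset.range F.length,
        if i ≤ j then (runs Step.D (F.getD i []) : ℤ) * (runs Step.U (F.getD j []) : ℤ)
          else 0)
      - (occ [Step.U, Step.D, Step.U] Q : ℤ)
      - (occ [Step.D, Step.U, Step.D] Q : ℤ)
      + (runs Step.H Q : ℤ) := by
  have hV : V Q 0 := (isSchroder_iff Q).1 hQ
  have hbal := V_counts hV
  have hpos : 0 < Q.count U + Q.count H := by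
    rcases head_cases Q with h | ⟨a, Q', h⟩
    · exact (hne h).elim
    · by_contra hz
      have hz1 : Q.count U = 0 := by omega
      have hz2 : Q.count H = 0 := by omega
      rw [h] at hbal hz1 hz2
      cases a with
      | U => simp at hz1
      | H => simp at hz2
      | D => rw [hz1, List.count_cons_self] at hbal; omega
  have hmem : ∀ P : List Step, (IsSchroder P ∧ P.Sublist Q ∧
      semilength P = semilength Q - 1) ↔ P ∈ delP Q 0 ∪ del H Q := by
    intro P
    rw [Finset.mem_union, mem_delP _ _ _ hV, isSchroder_iff]
    simp only [semilength, countU, countH]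
    constructor
    · rintro ⟨h1, h2, h3⟩
      have b1 := V_counts h1
      have c1 := h2.count_le U
      have c2 := h2.count_le H
      by_cases hu : P.count U = Q.count U
      · right
        rw [mem_del]
        refine ⟨h2, fun t => ?_⟩
        cases t <;> simp <;> omega
      · left
        exact ⟨h1, h2, by omega, by omega, by omega⟩
    · rintro (⟨h1, h2, h3, h4, h5⟩ | h)
      · exact ⟨h1, h2, by omega⟩
      · have hv := V_of_delH _ _ _ hV h
        rw [mem_del] at h
        have hu := h.2 U
        have hh := h.2 H
        simp at hu hh
        exact ⟨hv, h.1, by omega⟩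
  have hcard : Nat.card {P : List Step // IsSchroder P ∧ P.Sublist Q ∧
      semilength P = semilength Q - 1} = (delP Q 0 ∪ del H Q).card := by
    rw [Nat.card_congr (Equiv.subtypeEquivRight hmem)]
    simp only [Nat.card_eq_fintype_card, Fintype.card_coe]
  have hdisj : Disjoint (delP Q 0) (del H Q) := by
    rw [Finset.disjoint_left]
    intro P hP hP2
    rw [mem_delP _ _ _ hV] at hP
    have := ((mem_del _ _ _).1 hP2).2 H
    simp at this
    omega
  rw [hcard, Finset.card_union_of_disjoint hdisj, card_del]
  have h1 := card_delP Q 0 hV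
  have h2 := numP_sum F hirr
  rw [← hfact] at h2
  rw [← h2, ← h1]
  push_cast
  ring
end

section
/- Let P be a Dyck word, i.e., a Schröder word containing no H steps. For h ≥ 0 let d_h(P) denote the number of Dyck words of semilength h that avoid P. Then for every n ≥ 0, the number of Schröder words of semilength n avoiding P satisfies s_n(P) = Σ_{h=0}^{n} binom(n+h, n−h) · d_h(P). -/
/-- `schroderAvoidCount n P` is the number of Schröder words of semilength `n`
avoiding the pattern `P` (i.e. not containing `P` as a not-necessarily-contiguous
subword). -/
noncomputable def schroderAvoidCount (n : ℕ) (P : List Step) : ℕ :=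
  Nat.card {w : List Step // IsSchroder w ∧ semilength w = n ∧ ¬ P.Sublist w}

/-- `dyckAvoidCount h P` is the number of Dyck words (Schröder words with no `H`
steps) of semilength `h` avoiding the pattern `P`. -/
noncomputable def dyckAvoidCount (h : ℕ) (P : List Step) : ℕ :=
  Nat.card {w : List Step // IsSchroder w ∧ countH w = 0 ∧ semilength w = h ∧ ¬ P.Sublist w}

theorem length_eq_counts (w : List Step) : w.length = countU w + countD w + countH w := by
  induction w with
  | nil => rfl
  | cons a w ih =>
    cases a <;> simp [countU, countD, countH] at ih ⊢ <;> omega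

/-- Delete all the `H` steps. -/
def strip (w : List Step) : List Step := w.filter (fun a => decide (a ≠ Step.H))

theorem strip_countU (w : List Step) : countU (strip w) = countU w := by
  simp [countU, strip, List.count_filter]

theorem strip_countD (w : List Step) : countD (strip w) = countD w := by
  simp [countD, strip, List.count_filter]

theorem strip_countH (w : List Step) : countH (strip w) = 0 := by
  simp [countH, strip, List.count_eq_zero]

theorem strip_eq_self {w : List Step} (h : countH w = 0) : strip w = w := by
  rw [countH, List.count_eq_zero] at h
  rw [strip, List.filter_eq_self]
  intro a ha
  simp only [decide_eq_true_eq]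
  rintro rfl
  exact h ha

theorem strip_isSchroder (w : List Step) : IsSchroder (strip w) ↔ IsSchroder w := by
  unfold IsSchroder
  rw [strip_countU, strip_countD]
  refine and_congr_left fun _ => ⟨fun h p hp => ?_, fun h q hq => ?_⟩
  · have := h (strip p) (hp.filter _)
    rwa [strip_countU, strip_countD] at this
  · obtain ⟨p, hp, rfl⟩ := List.prefix_filter_iff.1 hq
    have := h p hp
    rwa [← strip_countU, ← strip_countD] at this

theorem sublist_strip {P : List Step} (h : countH P = 0) (w : List Step) :
    P.Sublist (strip w) ↔ P.Sublist w := by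
  refine ⟨fun hs => hs.trans List.filter_sublist, fun hs => ?_⟩
  rw [← strip_eq_self h]
  exact hs.filter _

/-- Words obtained from `w` by inserting `k` steps `H`. -/
def insH : List Step → ℕ → Finset (List Step)
  | [], 0 => {[]}
  | [], k + 1 => (insH [] k).image (List.cons Step.H)
  | a :: w, 0 => (insH w 0).image (List.cons a)
  | a :: w, k + 1 => (insH w (k + 1)).image (List.cons a) ∪
      (insH (a :: w) k).image (List.cons Step.H)

theorem mem_insH (v w : List Step) (k : ℕ) (hw : countH w = 0) :
    v ∈ insH w k ↔ strip v = w ∧ countH v = k := by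
  induction v generalizing w k with
  | nil => 
    cases w <;> cases k <;> simp [insH, strip, countH]
  | cons b v ih =>
    cases w with
    | nil =>
      cases k with
      | zero => cases b <;> simp [insH, strip, countH]
      | succ k =>
        have := ih [] k hw
        cases b <;> simp_all [insH, strip, countH]
    | cons a w =>
      have hw' : countH w = 0 := by
        simp [countH, List.count_cons] at hw ⊢; exact hw.1
      have ha : a ≠ Step.H := by
        simp [countH, List.count_cons] at hw; exact hw.2
      cases k with
      | zero =>
        have := ih w 0 hw'
        cases b <;> cases a <;> simp_all [insH, strip, countH]
      | succ k =>
        have h1 := ih w (k+1) hw'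
        have h2 := ih (a :: w) k hw
        cases b <;> cases a <;> simp_all [insH, strip, countH]

theorem card_insH (w : List Step) (k : ℕ) (hw : countH w = 0) :
    (insH w k).card = (w.length + k).choose k := by
  induction w generalizing k with
  | nil =>
    induction k with
    | zero => simp [insH]
    | succ k ih =>
      rw [insH, Finset.card_image_of_injective _ List.cons_injective, ih]; simp
  | cons a w ihw =>
    have hw' : countH w = 0 := by
      simp [countH, List.count_cons] at hw ⊢; exact hw.1
    have ha : a ≠ Step.H := by
      simp [countH, List.count_cons] at hw; exact hw.2
    induction k with
    | zero => rw [insH, Finset.card_image_of_injective _ List.cons_injective, ihw _ hw']; simp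
    | succ k ih =>
      rw [insH, Finset.card_union_of_disjoint, Finset.card_image_of_injective _ List.cons_injective,
        Finset.card_image_of_injective _ List.cons_injective, ihw _ hw', ih]
      · have e1 : (a :: w).length + (k + 1) = (w.length + (k + 1)) + 1 := by simp; omega
        have e2 : (a :: w).length + k = w.length + (k + 1) := by simp; omega
        rw [e1, e2, Nat.choose_succ_succ, add_comm]
      · rw [Finset.disjoint_left]
        intro x hx hx'
        simp only [Finset.mem_image] at hx hx'
        obtain ⟨y, _, rfl⟩ := hx
        obtain ⟨z, _, hz⟩ := hx'
        exact ha (List.cons.inj hz).1.symm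

theorem finite_schroder (n : ℕ) : {w : List Step | IsSchroder w ∧ semilength w = n}.Finite := by
  haveI : Finite Step := Finite.of_surjective
    (fun i : Fin 3 => if i = 0 then Step.U else if i = 1 then Step.D else Step.H) (by
      intro a
      cases a
      · exact ⟨0, rfl⟩
      · exact ⟨1, rfl⟩
      · exact ⟨2, rfl⟩)
  refine (List.finite_length_le Step (2 * n)).subset ?_
  rintro w ⟨⟨_, h⟩, h'⟩
  have := length_eq_counts w
  simp only [semilength] at h'
  simp only [Set.mem_setOf_eq]
  omega

theorem schroder_avoid_dyck_pattern (P : List Step)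
    (hP : IsSchroder P) (hDyck : countH P = 0) (n : ℕ) :
    schroderAvoidCount n P =
      ∑ h ∈ Finset.range (n + 1), Nat.choose (n + h) (n - h) * dyckAvoidCount h P := by
  classical
  have fA : {w : List Step | IsSchroder w ∧ semilength w = n ∧ ¬ P.Sublist w}.Finite :=
    (finite_schroder n).subset fun w h => ⟨h.1, h.2.1⟩
  have fB : ∀ h, {w : List Step | IsSchroder w ∧ countH w = 0 ∧ semilength w = h ∧
      ¬ P.Sublist w}.Finite := fun h =>
    (finite_schroder h).subset fun w h => ⟨h.1, h.2.2.1⟩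
  have cA : schroderAvoidCount n P = fA.toFinset.card := by
    rw [← Set.ncard_eq_toFinset_card _ fA]; rfl
  have cB : ∀ h, dyckAvoidCount h P = (fB h).toFinset.card := fun h => by
    rw [← Set.ncard_eq_toFinset_card _ (fB h)]; rfl
  rw [cA, Finset.card_eq_sum_card_fiberwise (f := countU) (t := Finset.range (n + 1))]
  · refine Finset.sum_congr rfl fun h hh => ?_
    rw [Finset.mem_range] at hh
    rw [cB, Finset.card_eq_sum_card_fiberwise (f := strip) (t := (fB h).toFinset)]
    · rw [mul_comm, ← smul_eq_mul, ← Finset.sum_const]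
      refine Finset.sum_congr rfl fun w hw => ?_
      simp only [Set.Finite.mem_toFinset, Set.mem_setOf_eq] at hw
      obtain ⟨hw1, hw2, hw3, hw4⟩ := hw
      have hl := length_eq_counts w
      have hud := hw1.2
      simp only [semilength] at hw3
      have e : n + h = w.length + (n - h) := by omega
      rw [e, ← card_insH w (n - h) hw2]
      congr 1
      ext v
      rw [mem_insH v w _ hw2]
      simp only [Finset.mem_filter, Set.Finite.mem_toFinset, Set.mem_setOf_eq, semilength]
      constructor
      · rintro ⟨⟨⟨_, h1, _⟩, h2⟩, h3⟩
        exact ⟨h3, by omega⟩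
      · rintro ⟨rfl, h2⟩
        rw [strip_isSchroder] at hw1
        rw [sublist_strip hDyck] at hw4
        rw [strip_countU, strip_countH] at hw3
        exact ⟨⟨⟨hw1, by omega, hw4⟩, by omega⟩, rfl⟩
    · intro v hv
      simp only [Finset.coe_filter, Set.Finite.mem_toFinset, Set.mem_setOf_eq,
        Set.Finite.coe_toFinset] at hv ⊢
      obtain ⟨⟨h1, h2, h3⟩, h4⟩ := hv
      refine ⟨(strip_isSchroder v).2 h1, strip_countH v, ?_, ?_⟩
      · rw [semilength, strip_countU, strip_countH, h4]; rfl
      · rwa [sublist_strip hDyck]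
  · intro v hv
    simp only [Set.Finite.coe_toFinset, Set.mem_setOf_eq, semilength] at hv
    simp only [Finset.coe_range, Set.mem_Iio]
    omega
end

section
/- Define the extended Narayana numbers by N_{0,0} = 1, N_{i,0} = N_{0,j} = 0 for all i, j > 0, and N_{i,j} = (1/i)·binom(i,j)·binom(i,j−1) for i, j ≥ 1. Then for all n ≥ 0 and k ≥ 1, the number of Schröder words of semilength n avoiding the pattern (UD)^k (the word consisting of k consecutive copies of UD) equals Σ_{h=0}^{n} Σ_{j=0}^{k−1} binom(n+h, n−h) · N_{h,j}. -/
/-- The extended Narayana numbers: `N 0 0 = 1`, `N i 0 = N 0 j = 0` for `i, j > 0`,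
and `N i j = (1/i) * binom(i,j) * binom(i,j-1)` for `i, j ≥ 1`. -/
def narayana (i j : ℕ) : ℚ :=
  if i = 0 ∧ j = 0 then 1
  else if i = 0 ∨ j = 0 then 0
  else (1 / (i : ℚ)) * (Nat.choose i j : ℚ) * (Nat.choose i (j - 1) : ℚ)

namespace SchroderAux

/-- The last non-`H` letter of the (reversed) word is `U`. -/
def st : List Step → Bool
  | [] => false
  | Step.U :: _ => true
  | Step.D :: _ => false
  | Step.H :: l => st l

/-- Number of peaks (ignoring `H`) of a reversed word. -/
def pk : List Step → ℕ
  | [] => 0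
  | Step.U :: l => pk l
  | Step.D :: l => pk l + (if st l then 1 else 0)
  | Step.H :: l => pk l

/-- Ballot condition for reversed words. -/
def ok : List Step → Prop
  | [] => True
  | x :: l => ok l ∧ countD (x :: l) ≤ countU (x :: l)

/-- All words of length `m`. -/
def allW : ℕ → Finset (List Step)
  | 0 => {[]}
  | m + 1 => (allW m).image (List.cons Step.U) ∪ ((allW m).image (List.cons Step.D) ∪
      (allW m).image (List.cons Step.H))

lemma mem_allW (m : ℕ) (l : List Step) : l ∈ allW m ↔ l.length = m := by
  induction m generalizing l with
  | zero => simp [allW]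
  | succ m ih =>
    cases l with
    | nil => simp [allW]
    | cons x l => cases x <;> simp [allW, ih]

open Classical in
lemma card_succ (m : ℕ) (P : List Step → Prop) :
    ((allW (m + 1)).filter P).card =
      ((allW m).filter (fun l => P (Step.U :: l))).card +
      ((allW m).filter (fun l => P (Step.D :: l))).card +
      ((allW m).filter (fun l => P (Step.H :: l))).card := by
  have key : ∀ s : Step, (((allW m).image (List.cons s)).filter P).card =
      ((allW m).filter (fun l => P (s :: l))).card := by
    intro s
    rw [Finset.filter_image, Finset.card_image_of_injective _ (List.cons_injective)]
  rw [allW, Finset.filter_union, Finset.filter_union, Finset.card_union_of_disjoint,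
    Finset.card_union_of_disjoint, key, key, key, add_assoc]
  · rw [Finset.disjoint_left]
    intro x hx hy
    simp only [Finset.mem_filter, Finset.mem_image] at hx hy
    obtain ⟨⟨y, _, rfl⟩, _⟩ := hx
    simp at hy
  · rw [Finset.disjoint_left]
    intro x hx hy
    simp only [Finset.mem_filter, Finset.mem_image, Finset.mem_union] at hx hy
    obtain ⟨⟨y, _, rfl⟩, _⟩ := hx
    simp at hy

def Q (a b c p : ℕ) (s : Bool) (l : List Step) : Prop :=
  ok l ∧ countU l = a ∧ countD l = b ∧ countH l = c ∧ pk l = p ∧ st l = s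

open Classical in
noncomputable def X (m a b c p : ℕ) (s : Bool) : ℕ := ((allW m).filter (Q a b c p s)).card

lemma ok_le (l : List Step) (h : ok l) : countD l ≤ countU l := by
  cases l with
  | nil => simp [countD, countU]
  | cons x l => exact h.2

open Classical in
lemma X_zero_of_lt (m a b c p : ℕ) (s : Bool) (h : a < b) : X m a b c p s = 0 := by
  unfold X
  rw [Finset.card_eq_zero, Finset.filter_eq_empty_iff]
  rintro l _ ⟨h1, h2, h3, _⟩
  have := ok_le l h1
  omega

/-- Unsplit count. -/
def T (a b p : ℕ) : ℤ :=
  match b with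
  | 0 => if p = 0 then 1 else 0
  | b + 1 => (a.choose p : ℤ) * (b + 1).choose p - ((a + 1).choose p : ℤ) * b.choose p

def FU (a b p : ℕ) : ℤ :=
  match a with
  | 0 => 0
  | a + 1 => T a b p

def F (a b p : ℕ) (s : Bool) : ℤ := if s then FU a b p else T a b p - FU a b p

lemma T_diag (a p : ℕ) : T a (a + 1) p = 0 := by
  simp [T]; ring

lemma F_rec (a b p : ℕ) : F (a + 1) (b + 1) p false =
    F (a + 1) b p false + (match p with | 0 => 0 | q + 1 => F (a + 1) b q true) := by
  cases p with
  | zero => cases b <;> simp [F, FU, T]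
  | succ p =>
    cases b with
    | zero =>
      cases p with
      | zero => simp [F, FU, T]
      | succ p => simp [F, FU, T, Nat.choose_succ_succ]
    | succ b =>
      simp only [F, FU, T, Nat.choose_succ_succ]
      push_cast
      simp
      ring

open Classical in
/-- The part of words whose outermost letter is the given one. -/
noncomputable def Y (x : Step) (m a b c p : ℕ) (s : Bool) : ℕ :=
  ((allW m).filter (fun l => Q a b c p s (x :: l))).card

lemma X_succ (m a b c p : ℕ) (s : Bool) : X (m + 1) a b c p s =
    Y .U m a b c p s + Y .D m a b c p s + Y .H m a b c p s := card_succ m _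

open Classical in
lemma Y_zero (x : Step) (m a b c p : ℕ) (s : Bool) (h : ∀ l, ¬ Q a b c p s (x :: l)) :
    Y x m a b c p s = 0 := by
  unfold Y
  rw [Finset.card_eq_zero, Finset.filter_eq_empty_iff]
  exact fun l _ => h l

lemma Y_H (m a b c p : ℕ) (s : Bool) : Y .H m a b (c + 1) p s = X m a b c p s := by
  unfold Y X
  congr 1
  ext l
  simp only [Finset.mem_filter, and_congr_right_iff]
  intro _
  have := ok_le l
  simp [Q, ok, pk, st, countU, countD, countH] at *
  tauto

lemma Y_U (m a b c p : ℕ) (h : b ≤ a + 1) :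
    Y .U m (a + 1) b c p true = X m a b c p true + X m a b c p false := by
  classical
  unfold Y X
  rw [← Finset.card_union_of_disjoint]
  · congr 1
    ext l
    simp only [Finset.mem_filter, Finset.mem_union]
    simp [Q, ok, pk, st, countU, countD, countH] at *
    cases st l <;> simp <;> grind
  · rw [Finset.disjoint_left]
    intro l h1 h2
    simp [Q] at h1 h2
    grind

lemma Y_D_zero (m a b c : ℕ) (h : b + 1 ≤ a) :
    Y .D m a (b + 1) c 0 false = X m a b c 0 false := by
  classical
  unfold Y X
  congr 1
  ext l
  simp only [Finset.mem_filter]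
  simp [Q, ok, pk, st, countU, countD, countH] at *
  cases st l <;> simp <;> grind

lemma Y_D_succ (m a b c p : ℕ) (h : b + 1 ≤ a) :
    Y .D m a (b + 1) c (p + 1) false = X m a b c (p + 1) false + X m a b c p true := by
  classical
  unfold Y X
  rw [← Finset.card_union_of_disjoint]
  · congr 1
    ext l
    simp only [Finset.mem_filter, Finset.mem_union]
    simp [Q, ok, pk, st, countU, countD, countH] at *
    cases st l <;> simp <;> grind
  · rw [Finset.disjoint_left]
    intro l h1 h2
    simp [Q] at h1 h2
    grind

lemma Y_H_zero (m a b p : ℕ) (s : Bool) : Y .H m a b 0 p s = 0 :=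
  Y_zero _ _ _ _ _ _ _ (by intro l; simp [Q, countH])

lemma X_eq (m a b c p : ℕ) (s : Bool) (hm : a + b + c = m) (hab : b ≤ a) :
    (X m a b c p s : ℤ) = ((a + b + c).choose c : ℤ) * F a b p s := by
  induction m generalizing a b c p s with
  | zero =>
    obtain ⟨rfl, rfl, rfl⟩ : a = 0 ∧ b = 0 ∧ c = 0 := by omega
    classical
    unfold X
    cases s <;> cases p <;>
      simp [allW, Finset.filter_singleton, Q, ok, countU, countD, countH, pk, st, F, FU, T]
  | succ m ih =>
    -- the claim follows from the corresponding claim about the first two parts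
    suffices hs : ((Y .U m a b c p s + Y .D m a b c p s : ℕ) : ℤ) =
        (if a + b = 0 then 0 else ((a + b + c - 1).choose c : ℤ)) * F a b p s by
      rw [X_succ]
      push_cast at hs ⊢
      rw [hs]
      cases c with
      | zero =>
        rw [Y_H_zero, if_neg (by omega)]
        simp
      | succ c =>
        rw [Y_H, ih a b c p s (by omega) hab]
        split_ifs with h0
        · obtain ⟨rfl, rfl⟩ : a = 0 ∧ b = 0 := by omega
          simp
        · have e : a + b + (c + 1) = (a + b + c) + 1 := by ring
          rw [e, Nat.choose_succ_succ]
          push_cast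
          simp
          ring
    cases s with
    | true =>
      rw [Y_zero .D _ _ _ _ _ _ (by intro l; simp [Q, st])]
      cases a with
      | zero =>
        rw [Y_zero .U _ _ _ _ _ _ (by intro l; simp [Q, countU])]
        simp [F, FU]
      | succ a =>
        rw [Y_U _ _ _ _ _ hab, if_neg (by omega)]
        have e : a + 1 + b + c - 1 = a + b + c := by omega
        rw [e]
        rcases Nat.lt_or_ge a b with h | h
        · rw [X_zero_of_lt _ _ _ _ _ _ h, X_zero_of_lt _ _ _ _ _ _ h]
          obtain rfl : b = a + 1 := by omega
          simp [F, FU, T_diag]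
        · push_cast
          rw [ih _ _ _ _ _ (by omega) h, ih _ _ _ _ _ (by omega) h]
          simp [F, FU]
          ring
    | false =>
      rw [Y_zero .U _ _ _ _ _ _ (by intro l; simp [Q, st])]
      cases b with
      | zero =>
        rw [Y_zero .D _ _ _ _ _ _ (by intro l; simp [Q, countD])]
        cases a <;> simp [F, FU, T]
      | succ b =>
        obtain ⟨a, rfl⟩ : ∃ a', a = a' + 1 := ⟨a - 1, by omega⟩
        have e : a + 1 + (b + 1) + c - 1 = a + 1 + b + c := by omega
        rw [if_neg (by omega), e, F_rec]
        cases p with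
        | zero =>
          rw [Y_D_zero _ _ _ _ hab, zero_add, ih _ _ _ _ _ (by omega) (by omega)]
          simp
        | succ p =>
          rw [Y_D_succ _ _ _ _ _ hab, zero_add]
          push_cast
          rw [ih _ _ _ _ _ (by omega) (by omega), ih _ _ _ _ _ (by omega) (by omega)]
          ring

lemma T_narayana (h j : ℕ) : ((T h h j : ℤ) : ℚ) = narayana h j := by
  cases h with
  | zero => cases j <;> simp [T, narayana]
  | succ h =>
    cases j with
    | zero => simp [T, narayana]
    | succ j =>
      simp only [T, narayana]
      have h1 : ((h + 1).choose (j + 1) : ℚ) * (j + 1) = (h + 1) * h.choose j := by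
        have := Nat.add_one_mul_choose_eq h j
        exact_mod_cast this.symm
      have h2 : ((h + 1 + 1).choose (j + 1) : ℚ) = (h + 1).choose j + (h + 1).choose (j + 1) := by
        exact_mod_cast Nat.choose_succ_succ (h + 1) j
      have h3 : ((h + 1).choose (j + 1) : ℚ) = h.choose j + h.choose (j + 1) := by
        exact_mod_cast Nat.choose_succ_succ h j
      have h4 : ((h + 1).choose (j + 1) : ℚ) * (j + 1) = (h + 1).choose j * (h + 1 - j) := by
        rcases Nat.lt_or_ge (h + 1) j with hlt | hge
        · rw [Nat.choose_eq_zero_of_lt hlt, Nat.choose_eq_zero_of_lt (by omega)]; simp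
        · have := Nat.choose_succ_right_eq (h + 1) j
          have h5 : (((h + 1 - j : ℕ)) : ℚ) = h + 1 - j := by push_cast [Nat.cast_sub hge]; ring
          rw [← h5]
          exact_mod_cast this
      simp only [Nat.add_sub_cancel]
      rw [if_neg (by simp), if_neg (by simp)]
      push_cast
      rw [h2]
      have hne : (h + 1 : ℚ) ≠ 0 := by positivity
      have h6 : (h.choose (j + 1) : ℚ) = (h + 1).choose (j + 1) - h.choose j := by linarith
      have h7 : (h.choose j : ℚ) = (h + 1).choose (j + 1) * (j + 1) / (h + 1) := by
        field_simp; linarith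
      rw [h6, h7]
      field_simp
      linear_combination ((h + 1).choose (j + 1) : ℚ) * h4

lemma sub_iff (l : List Step) : ∀ k : ℕ,
    (((List.replicate k [Step.D, Step.U]).flatten).Sublist l ↔ k ≤ pk l) ∧
    ((Step.U :: (List.replicate k [Step.D, Step.U]).flatten).Sublist l ↔
      k + 1 ≤ pk l + (if st l then 1 else 0)) := by
  induction l with
  | nil => intro k; cases k <;> simp [pk, st, List.replicate_succ]
  | cons x l ih =>
    intro k
    have neq : ∀ (y : Step) (q : List Step), y ≠ x → ((y :: q).Sublist (x :: l) ↔
        (y :: q).Sublist l) := by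
      intro y q hy
      constructor
      · intro h
        cases h with
        | cons _ h => exact h
        | cons_cons _ h => exact absurd rfl hy
      · intro h; exact h.cons _
    constructor
    · cases k with
      | zero => simp
      | succ k =>
        have e := ih (k + 1)
        simp only [List.replicate_succ, List.flatten_cons, List.cons_append, List.nil_append] at e ⊢
        cases x with
        | U => rw [neq _ _ (by simp), e.1]; simp [pk]
        | D => rw [List.cons_sublist_cons, (ih k).2]; simp [pk]
        | H => rw [neq _ _ (by simp), e.1]; simp [pk]
    · cases x with
      | U => rw [List.cons_sublist_cons, (ih k).1]; simp [pk, st]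
      | D => rw [neq _ _ (by simp), (ih k).2]; simp [pk, st]
      | H => rw [neq _ _ (by simp), (ih k).2, pk, st]

lemma ok_iff (l : List Step) :
    ok l ↔ ∀ p : List Step, p <+: l.reverse → countD p ≤ countU p := by
  induction l with
  | nil => simp [ok, countD, countU]
  | cons x l ih =>
    rw [ok, ih]
    simp only [List.reverse_cons, List.prefix_concat_iff]
    constructor
    · rintro ⟨h1, h2⟩ p (rfl | hp)
      · simpa [countD, countU, List.count_cons] using h2
      · exact h1 p hp
    · intro h
      refine ⟨fun p hp => h p (Or.inr hp), ?_⟩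
      have := h _ (Or.inl rfl)
      simpa [countD, countU, List.count_cons] using this

lemma flat_rev (k : ℕ) : ((List.replicate k [Step.U, Step.D]).flatten).reverse =
    (List.replicate k [Step.D, Step.U]).flatten := by
  rw [List.reverse_flatten]; simp

lemma len (l : List Step) : l.length = countU l + countD l + countH l := by
  induction l with
  | nil => simp [countU, countD, countH]
  | cons x l ih => cases x <;> simp [countU, countD, countH] at * <;> omega

open Classical in
noncomputable def B (n k : ℕ) : Finset (List Step) :=
  ((Finset.range (n + 1)) ×ˢ ((Finset.range k) ×ˢ (Finset.univ : Finset Bool))).biUnion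
    (fun t => (allW (n + t.1)).filter (Q t.1 t.1 (n - t.1) t.2.1 t.2.2))

lemma mem_B (n k : ℕ) (w : List Step) : w.reverse ∈ B n k ↔
    IsSchroder w ∧ semilength w = n ∧
      ¬ ((List.replicate k [Step.U, Step.D]).flatten).Sublist w := by
  have h1 := ok_iff w.reverse
  have h2 := (sub_iff w.reverse k).1
  rw [← flat_rev, List.reverse_sublist] at h2
  rw [List.reverse_reverse] at h1
  have hl := len w
  unfold IsSchroder
  rw [← h1, h2]
  simp only [B, Finset.mem_biUnion, Finset.mem_product, Finset.mem_range, Finset.mem_univ,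
    Finset.mem_filter, mem_allW, Q, semilength, List.length_reverse, countU, countD, countH,
    List.count_reverse] at *
  constructor
  · rintro ⟨⟨h, j, s⟩, h⟩
    simp at h
    obtain ⟨h3, h4, h5, h6, h7, h8, h9, h10⟩ := h
    exact ⟨⟨h5, by omega⟩, by omega, by omega⟩
  · rintro ⟨⟨h3, h4⟩, h5, h6⟩
    exact ⟨⟨w.count Step.U, pk w.reverse, st w.reverse⟩, ⟨by simp; omega, by simp; omega⟩,
      by simp; omega, h3, rfl, h4.symm, by simp; omega, rfl, rfl⟩

lemma card_B (n k : ℕ) : (B n k).card = ∑ h ∈ Finset.range (n + 1), ∑ j ∈ Finset.range k,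
    (X (n + h) h h (n - h) j true + X (n + h) h h (n - h) j false) := by
  classical
  unfold B
  rw [Finset.card_biUnion, Finset.sum_product]
  · refine Finset.sum_congr rfl fun h _ => ?_
    rw [Finset.sum_product]
    refine Finset.sum_congr rfl fun j _ => ?_
    simp [X]
  · rintro ⟨h, j, s⟩ _ ⟨h', j', s'⟩ _ hne
    rw [Function.onFun, Finset.disjoint_left]
    intro l h1 h2
    simp only [Finset.mem_filter, Q] at h1 h2
    apply hne
    simp only [Prod.mk.injEq]
    grind

end SchroderAux

open SchroderAux in
theorem schroder_avoid_UDk (n k : ℕ) (hk : 1 ≤ k) :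
    (schroderAvoidCount n ((List.replicate k [Step.U, Step.D]).flatten) : ℚ) =
      ∑ h ∈ Finset.range (n + 1), ∑ j ∈ Finset.range k,
        (Nat.choose (n + h) (n - h) : ℚ) * narayana h j := by
  have hc : schroderAvoidCount n ((List.replicate k [Step.U, Step.D]).flatten) = (B n k).card := by
    unfold schroderAvoidCount
    rw [show (B n k).card = Nat.card {l // l ∈ B n k} by simp]
    refine Nat.card_congr
      { toFun := fun w => ⟨w.1.reverse, (mem_B n k w.1).2 w.2⟩
        invFun := fun l => ⟨l.1.reverse, (mem_B n k _).1 (by simpa using l.2)⟩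
        left_inv := fun w => by simp
        right_inv := fun w => by simp }
  rw [hc, card_B]
  push_cast
  refine Finset.sum_congr rfl fun h hh => Finset.sum_congr rfl fun j _ => ?_
  have hn : h ≤ n := by simpa [Nat.lt_succ_iff] using hh
  have e : h + h + (n - h) = n + h := by omega
  have h1 := X_eq (n + h) h h (n - h) j true e le_rfl
  have h2 := X_eq (n + h) h h (n - h) j false e le_rfl
  rw [e] at h1 h2
  have h3 : ((X (n + h) h h (n - h) j true : ℤ) + X (n + h) h h (n - h) j false) =
      ((n + h).choose (n - h) : ℤ) * T h h j := by
    rw [h1, h2]; simp [F]; ring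
  rw [← T_narayana]
  exact_mod_cast h3
end

section
/- For every n ≥ 0, the number of Schröder words of semilength n avoiding the pattern UDUD equals Σ_{h=0}^{n} binom(2n−h, h). -/
open Step in
/-- Words with `h` letters `H` whose remaining letters spell `s`. -/
def enumW : List Step → ℕ → Finset (List Step)
  | [], 0 => {[]}
  | [], h+1 => (enumW [] h).map ⟨List.cons H, List.cons_injective⟩
  | a :: s, 0 => (enumW s 0).map ⟨List.cons a, List.cons_injective⟩
  | a :: s, h+1 => (enumW (a :: s) h).map ⟨List.cons H, List.cons_injective⟩ ∪
      (enumW s (h+1)).map ⟨List.cons a, List.cons_injective⟩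

lemma card_enumW (s : List Step) (h : ℕ) (hs : Step.H ∉ s) :
    (enumW s h).card = (s.length + h).choose h := by
  fun_induction enumW s h with
  | case1 => simp
  | case2 h ih => simp [ih]
  | case3 a s ih => 
    rw [Finset.card_map, ih (by simp_all)]; simp
  | case4 a s h ih1 ih2 =>
    rw [Finset.card_union_of_disjoint, Finset.card_map, Finset.card_map, ih1 hs,
      ih2 (by simp_all)]
    · have e : (a :: s).length + (h+1) = ((a :: s).length + h) + 1 := by omega
      rw [e, Nat.choose_succ_succ]
      congr 2
      simp; omega
    · rw [Finset.disjoint_left]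
      intro x hx hy
      simp only [Finset.mem_map, Function.Embedding.coeFn_mk] at hx hy
      obtain ⟨y, -, rfl⟩ := hx
      obtain ⟨z, -, hz⟩ := hy
      injection hz with h1 h2
      simp_all

lemma mem_enumW (s : List Step) (h : ℕ) (hs : Step.H ∉ s) (w : List Step) :
    w ∈ enumW s h ↔ w.filter (· ≠ Step.H) = s ∧ w.count Step.H = h := by
  induction w generalizing s h with
  | nil =>
    cases s <;> cases h <;> simp [enumW]
  | cons x w ih =>
    rcases s with _ | ⟨a, s⟩ <;> rcases h with _ | h
    · by_cases hx : x = Step.H <;> simp [enumW, hx]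
    · have := ih [] h hs
      by_cases hx : x = Step.H
      · subst hx; simp_all [enumW]
      · simp_all [enumW, Ne.symm hx]
    · have := ih s 0 (by simp_all)
      by_cases hx : x = Step.H
      · subst hx; simp_all [enumW]
        tauto
      · simp_all [enumW, eq_comm, and_assoc]
        tauto
    · have := ih s (h+1) (by simp_all)
      have := ih (a :: s) h hs
      by_cases hx : x = Step.H
      · subst hx; simp_all [enumW]
        tauto
      · simp_all [enumW, eq_comm, and_assoc]
        tauto

lemma countU_filter (w : List Step) : countU (w.filter (· ≠ Step.H)) = countU w := by
  simp [countU, List.count_filter]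
lemma countD_filter (w : List Step) : countD (w.filter (· ≠ Step.H)) = countD w := by
  simp [countD, List.count_filter]

lemma isSchroder_filter (w : List Step) :
    IsSchroder w ↔ IsSchroder (w.filter (· ≠ Step.H)) := by
  unfold IsSchroder
  rw [countU_filter, countD_filter]
  refine and_congr_left fun _ => ⟨fun hw p hp => ?_, fun hw p hp => ?_⟩
  · obtain ⟨q, hq, rfl⟩ := List.prefix_filter_iff.1 hp
    rw [countU_filter, countD_filter]; exact hw q hq
  · rw [← countU_filter, ← countD_filter p]; exact hw _ (hp.filter _)

lemma avoid_filter (w : List Step) :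
    [Step.U, Step.D, Step.U, Step.D].Sublist w ↔
      [Step.U, Step.D, Step.U, Step.D].Sublist (w.filter (· ≠ Step.H)) := by
  refine ⟨fun h => ?_, fun h => h.trans List.filter_sublist⟩
  simpa using h.filter (· ≠ Step.H)

lemma split_run (x : Step) (s : List Step) :
    ∃ a t, s = List.replicate a x ++ t ∧ t.head? ≠ some x := by
  induction s with
  | nil => exact ⟨0, [], by simp⟩
  | cons y s ih =>
    obtain ⟨a, t, rfl, ht⟩ := ih
    by_cases hy : y = x
    · subst hy; exact ⟨a+1, t, by simp [List.replicate_succ], ht⟩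
    · exact ⟨0, _, rfl, by simpa using hy⟩

lemma key1 (s : List Step) (hs : Step.H ∉ s) (h1 : IsSchroder s)
    (h2 : ¬ [Step.U, Step.D, Step.U, Step.D].Sublist s) :
    s = List.replicate (countU s) Step.U ++ List.replicate (countU s) Step.D := by
  obtain ⟨a, r, rfl, hr⟩ := split_run Step.U s
  obtain ⟨b, t, rfl, ht⟩ := split_run Step.D r
  obtain ⟨hp, hc⟩ := h1
  rcases t with _ | ⟨x, t⟩
  · simp [countU, countD, List.count_replicate] at hc ⊢
    exact hc.symm
  · exfalso
    have hx : x = Step.U := by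
      cases x <;> simp_all
    subst hx
    have hb : b ≠ 0 := by
      rintro rfl; simp at hr
    have h3 := hp (List.replicate a Step.U ++ List.replicate b Step.D) ⟨Step.U :: t, by simp⟩
    simp [countU, countD, List.count_replicate] at hc h3
    have ha : a ≠ 0 := by omega
    have hD : Step.D ∈ t := by
      rw [← List.count_pos_iff]; omega
    apply h2
    have e1 : [Step.U].Sublist (List.replicate a Step.U) := by simp [ha]
    have e2 : [Step.D].Sublist (List.replicate b Step.D) := by simp [hb]
    have e3 : [Step.D].Sublist t := by simpa using hD
    exact e1.append (e2.append (e3.cons_cons Step.U))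

lemma key2 (k : ℕ) :
    IsSchroder (List.replicate k Step.U ++ List.replicate k Step.D) ∧
    ¬ [Step.U, Step.D, Step.U, Step.D].Sublist
      (List.replicate k Step.U ++ List.replicate k Step.D) := by
  refine ⟨⟨fun p hp => ?_, by simp [countU, countD, List.count_replicate]⟩, fun h => ?_⟩
  · rcases List.prefix_or_prefix_of_prefix hp (List.prefix_append _ _) with h | ⟨t, rfl⟩
    · have := h.sublist.count_le Step.D
      simp [List.count_replicate] at this
      simp [countD, this]
    · have := hp.sublist.count_le Step.D
      simp [countU, countD, List.count_replicate] at this ⊢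
      omega
  · have : (List.replicate k Step.U ++ List.replicate k Step.D).Pairwise
        (fun a b => ¬ (a = Step.D ∧ b = Step.U)) := by
      simp [List.pairwise_append, List.pairwise_replicate]
    have := this.sublist h
    simp at this

theorem schroder_avoid_UDUD (n : ℕ) :
    schroderAvoidCount n [Step.U, Step.D, Step.U, Step.D] =
      ∑ h ∈ Finset.range (n + 1), Nat.choose (2 * n - h) h := by
  let f : ℕ → Finset (List Step) := fun h =>
    enumW (List.replicate (n-h) Step.U ++ List.replicate (n-h) Step.D) h
  have hH : ∀ k, Step.H ∉ List.replicate k Step.U ++ List.replicate k Step.D := by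
    intro k; simp
  have hmem : ∀ w, (IsSchroder w ∧ semilength w = n ∧
      ¬ [Step.U, Step.D, Step.U, Step.D].Sublist w) ↔ w ∈ (Finset.range (n+1)).biUnion f := by
    intro w
    simp only [Finset.mem_biUnion, f, mem_enumW _ _ (hH _), Finset.mem_range]
    rw [isSchroder_filter, avoid_filter]
    constructor
    · rintro ⟨h1, h2, h3⟩
      have h4 := key1 _ (by simp) h1 h3
      rw [countU_filter] at h4
      unfold semilength countH at h2
      refine ⟨w.count Step.H, by omega, ?_, rfl⟩
      rw [h4]
      congr 2 <;> omega
    · rintro ⟨h, hh, hf, hc⟩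
      have hU := countU_filter w
      rw [hf] at hU ⊢
      refine ⟨(key2 _).1, ?_, (key2 _).2⟩
      simp [countU, List.count_replicate] at hU
      unfold semilength countH countU
      omega
  unfold schroderAvoidCount
  rw [Nat.card_congr (Equiv.subtypeEquivRight hmem), Nat.card_eq_fintype_card,
    Fintype.card_coe, Finset.card_biUnion]
  · refine Finset.sum_congr rfl fun h hh => ?_
    simp only [f]
    rw [card_enumW _ _ (hH _)]
    congr 1
    simp at hh ⊢
    omega
  · intro i _ j _ hij
    refine Finset.disjoint_left.2 ?_
    intro w hi hj
    simp only [f, mem_enumW _ _ (hH _)] at hi hj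
    exact hij (hi.2.symm.trans hj.2)
end

section
/- For every n ≥ 0, the number of Schröder words of semilength n avoiding the pattern UDUD equals F_{2n+1}, the Fibonacci number of index 2n+1 (with F_0 = 0, F_1 = 1). -/
namespace SchAux

/-- The word with its horizontal steps removed. -/
def red (w : List Step) : List Step := w.filter (fun s => decide (s ≠ Step.H))

lemma red_U (w) : red (Step.U :: w) = Step.U :: red w := by simp [red]
lemma red_D (w) : red (Step.D :: w) = Step.D :: red w := by simp [red]
lemma red_H (w) : red (Step.H :: w) = red w := by simp [red]
lemma red_append (v w) : red (v ++ w) = red v ++ red w := by simp [red]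
lemma red_nil : red [] = [] := rfl

lemma count_red_U (w) : (red w).count Step.U = w.count Step.U := by
  unfold red; rw [List.count_filter]; simp
lemma count_red_D (w) : (red w).count Step.D = w.count Step.D := by
  unfold red; rw [List.count_filter]; simp

/-- The shape U^k D^k. -/
def shape (k : ℕ) : List Step := List.replicate k Step.U ++ List.replicate k Step.D

lemma shape_succ (k) : shape (k + 1) = Step.U :: (shape k ++ [Step.D]) := by
  simp only [shape, List.replicate_succ, List.cons_append, List.append_assoc]
  rw [← List.replicate_succ, List.replicate_succ']

/-- Reduced word is U^k D^k, of semilength n. -/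
def Q (n : ℕ) (w : List Step) : Prop := ∃ k, red w = shape k ∧ k + w.count Step.H = n

lemma Q_H (n w) : Q (n + 1) (Step.H :: w) ↔ Q n w := by
  unfold Q
  refine exists_congr fun k => ?_
  rw [red_H, List.count_cons_self]
  refine and_congr_right fun _ => by omega

lemma Q_H' (n w) : Q (n + 1) (w ++ [Step.H]) ↔ Q n w := by
  unfold Q
  refine exists_congr fun k => ?_
  rw [red_append, red_H, red_nil, List.append_nil, List.count_append, List.count_cons_self]
  refine and_congr_right fun _ => by simp; omega

lemma Q_UD (n w) : Q (n + 1) (Step.U :: (w ++ [Step.D])) ↔ Q n w := by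
  unfold Q
  constructor
  · rintro ⟨k, h, hk⟩
    rw [red_U, red_append, red_D, red_nil] at h
    cases k with
    | zero => simp [shape] at h
    | succ k =>
      rw [shape_succ] at h
      refine ⟨k, by simpa using h, ?_⟩
      simp at hk
      omega
  · rintro ⟨k, h, hk⟩
    refine ⟨k + 1, ?_, ?_⟩
    · rw [red_U, red_append, red_D, red_nil, h, shape_succ]
    · simp; omega

lemma Q_UU (n w) : ¬ Q n (Step.U :: (w ++ [Step.U])) := by
  rintro ⟨k, h, hk⟩
  rw [red_U, red_append, red_U, red_nil] at h
  cases k with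
  | zero => simp [shape] at h
  | succ k =>
    rw [shape_succ] at h
    have h2 := (List.cons.inj h).2
    have := congrArg List.getLast? h2
    simp at this

lemma Q_U (n) : ¬ Q n [Step.U] := by
  rintro ⟨k, h, hk⟩
  have h1 := congrArg (List.count Step.U) h
  have h2 := congrArg (List.count Step.D) h
  simp [red, shape, List.count_replicate] at h1 h2
  omega

lemma Q_D (n w) : ¬ Q n (Step.D :: w) := by
  rintro ⟨k, h, hk⟩
  rw [red_D] at h
  cases k with
  | zero => simp [shape] at h
  | succ k => rw [shape_succ] at h; simp at h

/-- Pairs of finsets: all words, and words starting with U. -/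
def AB : ℕ → Finset (List Step) × Finset (List Step)
  | 0 => ({[]}, ∅)
  | n + 1 =>
    let B := (AB n).2.image (fun w => w ++ [Step.H]) ∪
      (AB n).1.image (fun w => Step.U :: (w ++ [Step.D]))
    ((AB n).1.image (fun w => Step.H :: w) ∪ B, B)

lemma mem_AB (n : ℕ) : (∀ w, w ∈ (AB n).1 ↔ Q n w) ∧
    (∀ w, w ∈ (AB n).2 ↔ Q n w ∧ ∃ v, w = Step.U :: v) := by
  induction n with
  | zero =>
    have key : ∀ w, Q 0 w ↔ w = [] := by
      intro w
      constructor
      · rintro ⟨k, h, hk⟩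
        have hk0 : k = 0 := by omega
        have hc : w.count Step.H = 0 := by omega
        subst hk0
        rw [List.count_eq_zero] at hc
        cases w with
        | nil => rfl
        | cons a t => cases a <;> simp_all [red, shape]
      · rintro rfl
        exact ⟨0, by simp [red, shape], by simp⟩
    constructor
    · intro w; rw [key]; simp [AB]
    · intro w; rw [key]; simp only [AB]
      constructor
      · simp
      · rintro ⟨rfl, v, hv⟩; simp at hv
  | succ n ih =>
    obtain ⟨ihA, ihB⟩ := ih
    have hB : ∀ w, w ∈ (AB (n+1)).2 ↔ Q (n+1) w ∧ ∃ v, w = Step.U :: v := by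
      intro w
      simp only [AB, Finset.mem_union, Finset.mem_image, ihA, ihB]
      constructor
      · rintro (⟨v, ⟨h, u, rfl⟩, rfl⟩ | ⟨v, h, rfl⟩)
        · exact ⟨(Q_H' _ _).2 h, u ++ [Step.H], rfl⟩
        · exact ⟨(Q_UD _ _).2 h, _, rfl⟩
      · rintro ⟨h, v, rfl⟩
        rcases List.eq_nil_or_concat v with rfl | ⟨u, s, rfl⟩
        · exact absurd h (Q_U _)
        · rw [List.concat_eq_append] at *
          cases s with
          | U => exact absurd h (Q_UU _ _)
          | D => exact Or.inr ⟨u, (Q_UD _ _).1 h, rfl⟩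
          | H => exact Or.inl ⟨Step.U :: u, ⟨(Q_H' n (Step.U :: u)).1 h, u, rfl⟩, rfl⟩
    refine ⟨?_, hB⟩
    intro w
    have e : w ∈ (AB (n+1)).1 ↔ (∃ v ∈ (AB n).1, Step.H :: v = w) ∨ w ∈ (AB (n+1)).2 := by
      simp only [AB, Finset.mem_union, Finset.mem_image]
    rw [e, hB]
    constructor
    · rintro (⟨v, h, rfl⟩ | h)
      · exact (Q_H _ _).2 ((ihA _).1 h)
      · exact h.1
    · intro h
      cases w with
      | nil =>
        obtain ⟨k, h, hk⟩ := h
        cases k with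
        | zero => simp at hk
        | succ k => simp [shape_succ, red] at h
      | cons a t =>
        cases a with
        | U => exact Or.inr ⟨h, t, rfl⟩
        | D => exact absurd h (Q_D _ _)
        | H => exact Or.inl ⟨t, (ihA _).2 ((Q_H _ _).1 h), rfl⟩

lemma card_AB (n : ℕ) : (AB n).1.card = Nat.fib (2 * n + 1) ∧ (AB n).2.card = Nat.fib (2 * n) := by
  induction n with
  | zero => simp [AB]
  | succ n ih =>
    have hB : (AB (n+1)).2.card = Nat.fib (2 * (n + 1)) := by
      simp only [AB]
      rw [Finset.card_union_of_disjoint, Finset.card_image_of_injective,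
        Finset.card_image_of_injective, ih.1, ih.2]
      · rw [show 2 * (n + 1) = 2 * n + 2 by ring, Nat.fib_add_two]
      · intro a b h; simpa using h
      · intro a b h; simpa using h
      · rw [Finset.disjoint_left]
        intro w h1 h2
        simp only [Finset.mem_image] at h1 h2
        obtain ⟨a, -, rfl⟩ := h1
        obtain ⟨b, -, h⟩ := h2
        have := congrArg List.getLast? h
        rw [← List.cons_append] at this
        simp only [List.getLast?_append] at this
        simp at this
    refine ⟨?_, hB⟩
    have e : (AB (n+1)).1 = (AB n).1.image (fun w => Step.H :: w) ∪ (AB (n+1)).2 := rfl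
    rw [e, Finset.card_union_of_disjoint, Finset.card_image_of_injective, ih.1, hB]
    · rw [show 2 * (n + 1) + 1 = (2 * n + 1) + 2 by ring, Nat.fib_add_two]
      rfl
    · intro a b h; simpa using h
    · rw [Finset.disjoint_left]
      intro w h1 h2
      obtain ⟨-, v, rfl⟩ := ((mem_AB _).2 _).1 h2
      simp at h1

/-- Sortedness relation: after a D only D. -/
def R (a b : Step) : Prop := a = Step.D → b = Step.D

lemma shape_pairwise (k) : (shape k).Pairwise R := by
  unfold shape
  rw [List.pairwise_append]
  refine ⟨?_, ?_, ?_⟩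
  · exact List.pairwise_replicate.2 (Or.inr (fun h => h))
  · exact List.pairwise_replicate.2 (Or.inr (fun h => h))
  · intro a _ b hb _
    exact List.eq_of_mem_replicate hb

lemma sorted_shape (l : List Step) (hH : Step.H ∉ l) (hp : l.Pairwise R) :
    l = List.replicate (l.count Step.U) Step.U ++ List.replicate (l.count Step.D) Step.D := by
  induction l with
  | nil => rfl
  | cons a t ih =>
    rw [List.pairwise_cons] at hp
    have ih := ih (fun h => hH (List.mem_cons_of_mem _ h)) hp.2
    cases a with
    | H => simp at hH
    | U =>
      rw [List.count_cons_self, List.replicate_succ, List.cons_append,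
        List.count_cons_of_ne (by decide)]
      rw [← ih]
    | D =>
      have ht : ∀ b ∈ t, b = Step.D := fun b hb => hp.1 b hb rfl
      have h0 : t.count Step.U = 0 := by
        rw [List.count_eq_zero]; intro h; exact absurd (ht _ h) (by decide)
      rw [List.count_cons_self, List.count_cons_of_ne (by decide), h0]
      rw [List.replicate_succ]
      rw [h0] at ih
      simpa using ih

lemma prefix_ok (w : List Step) (k) (h : red w = shape k) (p) (hp : p <+: w) :
    p.count Step.D ≤ p.count Step.U := by
  have h1 : red p <+: shape k := by rw [← h]; exact hp.filter _
  rw [← count_red_U, ← count_red_D, List.prefix_iff_eq_take.1 h1]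
  simp [shape, List.take_append, List.take_replicate, List.count_append, List.count_replicate]

lemma no_DU (w : List Step) (hw : IsSchroder w)
    (ha : ¬ [Step.U, Step.D, Step.U, Step.D].Sublist w) : ¬ [Step.D, Step.U].Sublist w := by
  intro h
  rw [List.cons_sublist_iff] at h
  obtain ⟨x, y, rfl, hx, hy⟩ := h
  rw [List.singleton_sublist] at hy
  obtain ⟨y1, y2, rfl⟩ := List.append_of_mem hy
  obtain ⟨x1, x2, rfl⟩ := List.append_of_mem hx
  obtain ⟨h1, h2⟩ := hw
  have p1 := h1 (x1 ++ [Step.D]) ⟨x2 ++ (y1 ++ Step.U :: y2), by simp⟩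
  have p2 := h1 (x1 ++ Step.D :: x2 ++ y1) ⟨Step.U :: y2, by simp⟩
  simp [countU, countD] at p1 p2 h2
  have c1 : Step.U ∈ x1 := List.count_pos_iff.1 (by omega)
  have c2 : Step.D ∈ y2 := List.count_pos_iff.1 (by omega)
  apply ha
  have s1 : [Step.U].Sublist x1 := List.singleton_sublist.2 c1
  have s2 : [Step.D].Sublist y2 := List.singleton_sublist.2 c2
  have s3 : [Step.D].Sublist (Step.D :: x2) := by simp
  have s4 : [Step.U, Step.D].Sublist (y1 ++ Step.U :: y2) :=
    (s2.cons_cons Step.U).trans (List.sublist_append_right _ _)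
  exact (s1.append s3).append s4

lemma char (n w) : (IsSchroder w ∧ semilength w = n ∧
    ¬ [Step.U, Step.D, Step.U, Step.D].Sublist w) ↔ Q n w := by
  constructor
  · rintro ⟨hw, hn, ha⟩
    have hdu := no_DU w hw ha
    have hs : (red w).Pairwise R := by
      rw [List.pairwise_iff_forall_sublist]
      intro a b hab haD
      have hb : b ∈ red w := hab.subset (by simp)
      cases b with
      | D => rfl
      | H => simp [red] at hb
      | U => subst haD; exact absurd (hab.trans List.filter_sublist) hdu
    have := sorted_shape (red w) (by simp [red]) hs
    rw [count_red_D, count_red_U] at this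
    have h2 := hw.2
    simp only [countU, countD] at h2
    refine ⟨w.count Step.U, ?_, hn⟩
    rw [this, ← h2]; rfl
  · rintro ⟨k, h, hk⟩
    have cU := count_red_U w
    have cD := count_red_D w
    rw [h] at cU cD
    simp [shape, List.count_replicate] at cU cD
    refine ⟨⟨fun p hp => prefix_ok w k h p hp, ?_⟩, ?_, ?_⟩
    · simp only [countU, countD]; omega
    · simp only [semilength, countU, countH]; omega
    · intro hs
      have h1 : (red [Step.U, Step.D, Step.U, Step.D]).Sublist (red w) := hs.filter _
      rw [h] at h1
      have h2 := (shape_pairwise k).sublist h1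
      simp [red, R] at h2

end SchAux

theorem schroder_avoid_UDUD_fib (n : ℕ) :
    schroderAvoidCount n [Step.U, Step.D, Step.U, Step.D] = Nat.fib (2 * n + 1) := by
  unfold schroderAvoidCount
  rw [← (SchAux.card_AB n).1]
  apply Nat.subtype_card
  intro w
  rw [SchAux.char, (SchAux.mem_AB n).1]
end

section
/- For every n ≥ 3, the number of Schröder words of semilength n avoiding the pattern UUDD equals 1 + binom(n+1, n−1) + binom(n+2, n−2) = 1 + n(n+1)(n² + n + 10)/24. -/
open Step in
/-- Remove all horizontal steps. -/
def core (w : List Step) : List Step := w.filter (fun s => decide (s ≠ Step.H))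

theorem countU_core (w : List Step) : countU (core w) = countU w := by
  simp [countU, core, List.count_filter]

theorem countD_core (w : List Step) : countD (core w) = countD w := by
  simp [countD, core, List.count_filter]

theorem core_not_H (w : List Step) : Step.H ∉ core w := by
  simp [core]

/-- All ways to insert `m` horizontal steps into the word `v`. -/
def shuf : List Step → ℕ → Finset (List Step)
  | [], 0 => {[]}
  | [], (m+1) => (shuf [] m).image (List.cons Step.H)
  | (a :: v), 0 => (shuf v 0).image (List.cons a)
  | (a :: v), (m+1) => (shuf v (m+1)).image (List.cons a) ∪ (shuf (a :: v) m).image (List.cons Step.H)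

theorem mem_shuf (v : List Step) (m : ℕ) (hv : Step.H ∉ v) (w : List Step) :
    w ∈ shuf v m ↔ core w = v ∧ countH w = m := by
  induction w generalizing v m with
  | nil =>
    rcases v with _ | ⟨a, v⟩ <;> rcases m with _ | m <;> simp [shuf, core, countH]
  | cons b w ih =>
    rcases v with _ | ⟨a, v⟩ <;> rcases m with _ | m
    · have := ih [] 0
      cases b <;> simp [shuf, core, countH]
    · have := ih [] m
      cases b <;> simp_all [shuf, core, countH]
    · have := ih v 0
      cases b <;> cases a <;> simp_all [shuf, core, countH]
    · have h1 := ih v (m+1)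
      have h2 := ih (a :: v) m
      cases b <;> cases a <;> simp_all [shuf, core, countH]

theorem card_shuf (v : List Step) (m : ℕ) (hv : Step.H ∉ v) :
    (shuf v m).card = Nat.choose (m + v.length) v.length := by
  fun_induction shuf v m with
  | case1 => simp
  | case2 m ih =>
    rw [Finset.card_image_of_injective _ List.cons_injective, ih hv]; simp
  | case3 a v ih =>
    rw [Finset.card_image_of_injective _ List.cons_injective, ih (by simp_all)]; simp
  | case4 a v m ih1 ih2 =>
    rw [Finset.card_union_of_disjoint, Finset.card_image_of_injective _ List.cons_injective,
      Finset.card_image_of_injective _ List.cons_injective, ih1 (by simp_all), ih2 hv]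
    · simp only [List.length_cons]
      rw [show m + 1 + (v.length + 1) = (m + 1 + v.length) + 1 by ring, Nat.choose_succ_succ,
        show m + (v.length + 1) = m + 1 + v.length by ring]
    · rw [Finset.disjoint_left]
      intro x hx hy
      simp only [Finset.mem_image] at hx hy
      obtain ⟨y, _, rfl⟩ := hx
      obtain ⟨z, _, hz⟩ := hy
      simp only [List.cons.injEq] at hz
      apply hv
      simp [hz.1]

theorem schroder_of_core (w : List Step)
    (h : core w = [] ∨ core w = [.U, .D] ∨ core w = [.U, .D, .U, .D]) : IsSchroder w := by
  constructor
  · intro p hp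
    have hq : core p <+: core w := hp.filter _
    rw [← countU_core p, ← countD_core p]
    rcases h with h | h | h <;> rw [h] at hq <;> rw [← List.mem_inits] at hq <;>
      simp [List.inits] at hq
    · simp [hq, countU, countD]
    · rcases hq with hq | hq | hq <;> rw [hq] <;> decide
    · rcases hq with hq | hq | hq | hq | hq <;> rw [hq] <;> decide
  · rw [← countU_core w, ← countD_core w]
    rcases h with h | h | h <;> rw [h] <;> decide

theorem sub_core (w : List Step) :
    [Step.U, .U, .D, .D].Sublist w ↔ [Step.U, .U, .D, .D].Sublist (core w) := by
  constructor
  · intro h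
    exact h.filter (fun s => decide (s ≠ Step.H))
  · intro h
    exact h.trans List.filter_sublist

theorem pre_core (w q : List Step) (hw : IsSchroder w) (hq : q <+: core w) :
    countD q ≤ countU q := by
  obtain ⟨r, hr⟩ := hq
  obtain ⟨p, s, h1, h2, h3⟩ := List.filter_eq_append_iff.1 hr.symm
  have := hw.1 p ⟨s, h1.symm⟩
  rw [← countU_core, ← countD_core] at this
  rwa [← h2]

theorem core_cases (v : List Step) (hH : Step.H ∉ v)
    (hp : ∀ q, q <+: v → countD q ≤ countU q) (he : countU v = countD v)
    (ha : ¬ [Step.U, .U, .D, .D].Sublist v) :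
    v = [] ∨ v = [.U, .D] ∨ v = [.U, .D, .U, .D] := by
  have key : ∀ t : List Step, 2 ≤ countD t → [Step.D, .D].Sublist t := fun t ht =>
    List.replicate_sublist_iff.2 ht
  have key1 : ∀ t : List Step, 1 ≤ countD t → [Step.D].Sublist t := fun t ht =>
    List.replicate_sublist_iff.2 ht
  rcases v with _ | ⟨_ | _ | _, v⟩
  · simp
  · rcases v with _ | ⟨_ | _ | _, v⟩
    · simp [countU, countD] at he
    · exact absurd (((key v (by simp [countU, countD] at he ⊢; omega)).cons_cons _).cons_cons _) ha
    · rcases v with _ | ⟨_ | _ | _, v⟩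
      · simp
      · rcases v with _ | ⟨_ | _ | _, v⟩
        · simp [countU, countD] at he
        · exact absurd (((((key v (by simp [countU, countD] at he ⊢; omega)).cons_cons _).cons_cons _).cons _).cons _) ha
        · rcases v with _ | ⟨_ | _ | _, v⟩
          · simp
          · exact absurd ((((((key1 v (by simp [countU, countD] at he; unfold countD; omega)).cons _).cons_cons _).cons_cons _).cons _).cons_cons _) ha
          · have := hp [.U, .D, .U, .D, .D] ⟨v, rfl⟩
            exact absurd this (by decide)
          · simp at hH
        · simp at hH
      · have := hp [.U, .D, .D] ⟨v, rfl⟩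
        exact absurd this (by decide)
      · simp at hH
    · simp at hH
  · have := hp [.D] ⟨v, rfl⟩
    exact absurd this (by decide)
  · simp at hH

theorem avoid_iff (n : ℕ) (w : List Step) :
    (IsSchroder w ∧ semilength w = n + 2 ∧ ¬ [Step.U, .U, .D, .D].Sublist w) ↔
    w ∈ shuf [] (n + 2) ∪ (shuf [.U, .D] (n + 1) ∪ shuf [.U, .D, .U, .D] n) := by
  simp only [Finset.mem_union]
  rw [mem_shuf _ _ (by simp), mem_shuf _ _ (by simp), mem_shuf _ _ (by simp)]
  unfold semilength
  rw [sub_core, ← countU_core]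
  constructor
  · rintro ⟨h1, h2, h3⟩
    have := core_cases (core w) (core_not_H w) (fun q hq => pre_core w q h1 hq)
      (by rw [countU_core, countD_core]; exact h1.2) h3
    rcases this with h | h | h <;> simp [h, countU] at h2 ⊢ <;> omega
  · intro h
    refine ⟨schroder_of_core w (by tauto), ?_⟩
    rcases h with ⟨h, h'⟩ | ⟨h, h'⟩ | ⟨h, h'⟩ <;> rw [h, h'] <;>
      refine ⟨by simp [countU]; try omega, by decide⟩

theorem count_formula (n : ℕ) : schroderAvoidCount (n + 2) [Step.U, Step.U, Step.D, Step.D] =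
    1 + Nat.choose (n + 3) 2 + Nat.choose (n + 4) 4 := by
  unfold schroderAvoidCount
  rw [Nat.card_congr (Equiv.subtypeEquivRight (avoid_iff n)), Nat.card_eq_fintype_card,
    Fintype.card_coe, Finset.card_union_of_disjoint, Finset.card_union_of_disjoint,
    card_shuf _ _ (by simp), card_shuf _ _ (by simp), card_shuf _ _ (by simp)]
  · simp [add_assoc]
  · rw [Finset.disjoint_left]
    intro x h1 h2
    rw [mem_shuf _ _ (by simp)] at h1 h2
    simp [h1.1] at h2
  · rw [Finset.disjoint_left]
    intro x h1 h2
    rw [Finset.mem_union, mem_shuf _ _ (by simp), mem_shuf _ _ (by simp)] at h2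
    rw [mem_shuf _ _ (by simp)] at h1
    simp [h1.1] at h2

theorem schroder_avoid_UUDD (n : ℕ) (hn : 3 ≤ n) :
    schroderAvoidCount n [Step.U, Step.U, Step.D, Step.D] =
      1 + Nat.choose (n + 1) (n - 1) + Nat.choose (n + 2) (n - 2) ∧
    (schroderAvoidCount n [Step.U, Step.U, Step.D, Step.D] : ℚ) =
      1 + (n : ℚ) * ((n : ℚ) + 1) * ((n : ℚ) ^ 2 + (n : ℚ) + 10) / 24 := by
  obtain ⟨m, rfl⟩ : ∃ m, n = m + 2 := ⟨n - 2, by omega⟩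
  rw [count_formula]
  constructor
  · rw [Nat.choose_symm_of_eq_add (n := m + 3) (a := 2) (b := m + 1) (by ring),
      Nat.choose_symm_of_eq_add (n := m + 4) (a := 4) (b := m) (by ring)]
    rfl
  · have h2 : ((Nat.choose (m + 3) 2 : ℕ) : ℚ) = (m + 3) * (m + 2) / 2 := by
      rw [Nat.cast_choose_two]; push_cast; ring
    have h4 : ((Nat.choose (m + 4) 4 : ℕ) : ℚ) = (m + 4) * (m + 3) * (m + 2) * (m + 1) / 24 := by
      have := Nat.ascFactorial_eq_factorial_mul_choose m 4
      have h' : ((m+1).ascFactorial 4 : ℚ) = ((Nat.factorial 4 * (m + 4).choose 4 : ℕ) : ℚ) := by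
        rw [this]
      simp [Nat.ascFactorial, Nat.factorial] at h'
      linarith
    push_cast
    rw [h2, h4]
    ring
end

section
/- For all n ≥ 0 and k ≥ 2, the number of Schröder words of semilength n avoiding the pattern U H^{k−1} D (one up step, then k−1 H steps, then one down step) equals 1 + Σ_{h=1}^{n} Σ_{i=0}^{min(k−2, n−h)} multichoose(2h−1, i) · (n−h−i+1) · C_h, where multichoose(m, i) = binom(m+i−1, i) is the multiset coefficient and C_h denotes the h-th Catalan number. -/
/-- The multiset coefficient: `multichoose m i = binom(m + i - 1, i)` counts
multisets of cardinality `i` from a set of cardinality `m`. -/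
def multichoose (m i : ℕ) : ℕ := Nat.choose (m + i - 1) i

namespace SchroderAux

/-- Embedding of Dyck steps into Schröder steps. -/
def emb : DyckStep → Step
  | DyckStep.U => Step.U
  | DyckStep.D => Step.D

lemma emb_inj : Function.Injective emb := by
  intro a b h; cases a <;> cases b <;> simp_all [emb]

lemma count_emb_U (e : List DyckStep) : (e.map emb).count Step.U = e.count DyckStep.U :=
  List.count_map_of_injective e emb emb_inj DyckStep.U

lemma count_emb_D (e : List DyckStep) : (e.map emb).count Step.D = e.count DyckStep.D :=
  List.count_map_of_injective e emb emb_inj DyckStep.D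

lemma exists_emb (d : List Step) (h : Step.H ∉ d) : ∃ e : List DyckStep, d = e.map emb := by
  induction d with
  | nil => exact ⟨[], rfl⟩
  | cons x d ih =>
    simp only [List.mem_cons, not_or] at h
    obtain ⟨e, rfl⟩ := ih h.2
    cases x with
    | U => exact ⟨DyckStep.U :: e, rfl⟩
    | D => exact ⟨DyckStep.D :: e, rfl⟩
    | H => exact absurd rfl h.1

lemma not_mem_emb (e : List DyckStep) : Step.H ∉ e.map emb := by
  intro h
  obtain ⟨a, -, ha⟩ := List.mem_map.1 h
  cases a <;> simp [emb] at ha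

lemma sch_map (e : List DyckStep) : IsSchroder (e.map emb) ↔
    (e.count DyckStep.U = e.count DyckStep.D ∧
      ∀ i, (e.take i).count DyckStep.D ≤ (e.take i).count DyckStep.U) := by
  unfold IsSchroder countU countD
  rw [count_emb_U, count_emb_D, and_comm]
  refine and_congr_right fun _ => ⟨fun h i => ?_, fun h p hp => ?_⟩
  · have := h ((e.take i).map emb) (⟨(e.drop i).map emb, by rw [← List.map_append, List.take_append_drop]⟩)
    rwa [count_emb_U, count_emb_D] at this
  · rw [List.prefix_iff_eq_take] at hp
    rw [hp, ← List.map_take, count_emb_U, count_emb_D]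
    exact h _

/-- Interiors of nonempty Dyck words. -/
noncomputable def dyckInner (h : ℕ) : Finset (List Step) :=
  (Finset.univ : Finset {p : DyckWord // p.semilength = h}).image
    (fun p => p.1.toList.dropLast.tail.map emb)

lemma map_full (p : DyckWord) (hp : 1 ≤ p.semilength) :
    Step.U :: p.toList.dropLast.tail.map emb ++ [Step.D] = p.toList.map emb := by
  have h0 : p ≠ 0 := by rintro rfl; simp at hp
  conv_rhs => rw [← p.cons_tail_dropLast_concat h0]
  simp [emb]

lemma card_dyckInner (h : ℕ) (hh : 1 ≤ h) : (dyckInner h).card = catalan h := by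
  rw [dyckInner, Finset.card_image_of_injective, Finset.card_univ,
    DyckWord.card_dyckWord_semilength_eq_catalan]
  rintro ⟨p, hp⟩ ⟨q, hq⟩ hpq
  have h1 := map_full p (by omega)
  have h2 := map_full q (by omega)
  simp only at hpq
  rw [hpq, h2] at h1
  have := emb_inj.list_map h1
  exact Subtype.ext (DyckWord.ext this.symm)

lemma mem_dyckInner (h : ℕ) (hh : 1 ≤ h) (d : List Step) : d ∈ dyckInner h ↔
    Step.H ∉ d ∧ IsSchroder (Step.U :: d ++ [Step.D]) ∧ countU d + 1 = h := by
  simp only [dyckInner, Finset.mem_image, Finset.mem_univ, true_and, Subtype.exists]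
  constructor
  · rintro ⟨p, hp, rfl⟩
    have h1 := map_full p (by omega)
    refine ⟨not_mem_emb _, ?_, ?_⟩
    · rw [h1, sch_map]; exact ⟨p.count_U_eq_count_D, p.count_D_le_count_U⟩
    · have := congrArg (List.count Step.U) h1
      rw [count_emb_U] at this
      simp only [List.cons_append, List.count_cons, List.count_append] at this
      simp [-List.map_dropLast, -List.map_tail] at this
      rw [← hp, countU, DyckWord.semilength, ← this]
  · rintro ⟨h1, h2, h3⟩
    obtain ⟨e, rfl⟩ := exists_emb d h1
    have he : Step.U :: e.map emb ++ [Step.D] =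
      (DyckStep.U :: e ++ [DyckStep.D]).map emb := by simp [emb]
    rw [he, sch_map] at h2
    refine ⟨⟨_, h2.1, h2.2⟩, ?_, ?_⟩
    · rw [countU, count_emb_U] at h3
      simp [DyckWord.semilength, h3]
    · simp [List.dropLast_cons_of_ne_nil]

lemma length_eq (d : List Step) : d.length = countU d + countD d + countH d := by
  induction d with
  | nil => rfl
  | cons x d ih => cases x <;> simp_all [countU, countD, countH] <;> omega

lemma length_inner (h : ℕ) (hh : 1 ≤ h) (d : List Step) (hd : d ∈ dyckInner h) :
    d.length = 2 * h - 2 := by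
  obtain ⟨h1, h2, h3⟩ := (mem_dyckInner h hh d).1 hd
  have h4 := h2.2
  have h5 : countH d = 0 := List.count_eq_zero.2 h1
  have h6 := length_eq d
  simp [countU, countD] at h3 h4 h6
  omega

/-- Removing horizontal steps. -/
def strip (w : List Step) : List Step := w.filter (fun x => decide (x ≠ Step.H))

lemma countU_strip (w) : countU (strip w) = countU w := by
  simp [countU, strip, List.count_filter]

lemma countD_strip (w) : countD (strip w) = countD w := by
  simp [countD, strip, List.count_filter]

lemma sch_strip (w) : IsSchroder (strip w) ↔ IsSchroder w := by
  unfold IsSchroder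
  rw [countU_strip, countD_strip]
  refine and_congr_left fun _ => ⟨fun h p hp => ?_, fun h p hp => ?_⟩
  · have := h (strip p) (hp.filter _)
    rwa [countU_strip, countD_strip] at this
  · obtain ⟨l, hl, rfl⟩ := List.prefix_filter_iff.1 hp
    have := h l hl
    rwa [← countU_strip, ← countD_strip] at this

/-- Words obtained from `d` by inserting `i` horizontal steps. -/
def sh : List Step → ℕ → Finset (List Step)
  | [], i => {List.replicate i Step.H}
  | x :: d, 0 => {x :: d}
  | x :: d, i + 1 => (sh d (i + 1)).image (List.cons x) ∪ (sh (x :: d) i).image (List.cons Step.H)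

lemma mem_sh (d : List Step) (i : ℕ) (hd : Step.H ∉ d) (m : List Step) :
    m ∈ sh d i ↔ strip m = d ∧ countH m = i := by
  induction d, i using sh.induct generalizing m with
  | case1 i =>
    simp only [sh, Finset.mem_singleton, strip, countH]
    constructor
    · rintro rfl; simp
    · rintro ⟨h1, h2⟩
      rw [← h2]
      have h3 : ∀ b ∈ m, b = Step.H := by simpa [List.filter_eq_nil_iff] using h1
      have h4 := List.eq_replicate_of_mem h3
      rw [h4]; simp
  | case2 x d =>
    simp only [sh, Finset.mem_singleton]
    constructor
    · rintro rfl
      refine ⟨List.filter_eq_self.2 ?_, List.count_eq_zero.2 hd⟩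
      intro a ha
      simp only [ne_eq, decide_eq_true_eq]
      rintro rfl; exact hd ha
    · rintro ⟨h1, h2⟩
      rw [← h1]
      refine (List.filter_eq_self.2 ?_).symm
      intro a ha
      simp only [ne_eq, decide_eq_true_eq]
      rintro rfl; exact List.count_eq_zero.1 h2 ha
  | case3 x d i ih1 ih2 =>
    have hd' := hd
    simp only [List.mem_cons, not_or] at hd'
    simp only [sh, Finset.mem_union, Finset.mem_image]
    simp only [ih1 hd'.2, ih2 hd]
    have hx : x ≠ Step.H := fun h => hd'.1 h.symm
    cases m with
    | nil => simp [strip]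
    | cons y m =>
      by_cases hy : y = Step.H
      · subst hy
        simp [strip, countH, hx]
      · simp [strip, countH, hy, Ne.symm hy]
        grind

lemma card_sh (d : List Step) (i : ℕ) (hd : Step.H ∉ d) :
    (sh d i).card = (d.length + i).choose i := by
  induction d, i using sh.induct with
  | case1 i => simp [sh]
  | case2 x d => simp [sh]
  | case3 x d i ih1 ih2 =>
    have hd' := hd
    simp only [List.mem_cons, not_or] at hd'
    rw [sh, Finset.card_union_of_disjoint, Finset.card_image_of_injective _ List.cons_injective,
      Finset.card_image_of_injective _ List.cons_injective, ih1 hd'.2, ih2 hd]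
    · simp only [List.length_cons]
      have := Nat.choose_succ_succ (d.length + 1 + i) i
      rw [show d.length + 1 + (i + 1) = (d.length + 1 + i) + 1 by ring,
        show d.length + (i + 1) = d.length + 1 + i by ring]
      rw [this, Nat.succ_eq_add_one, add_comm]
    · rw [Finset.disjoint_left]
      intro a ha hb
      simp only [Finset.mem_image] at ha hb
      obtain ⟨u, -, rfl⟩ := ha
      obtain ⟨v, -, hv⟩ := hb
      simp only [List.cons.injEq] at hv
      exact hd'.1 hv.1

/-- Middle parts with `h - 1` up steps and `i` horizontal steps. -/
noncomputable def mid (h i : ℕ) : Finset (List Step) := (dyckInner h).biUnion fun d => sh d i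

lemma mem_mid (h i : ℕ) (hh : 1 ≤ h) (m : List Step) : m ∈ mid h i ↔
    IsSchroder (Step.U :: m ++ [Step.D]) ∧ countU m + 1 = h ∧ countH m = i := by
  simp only [mid, Finset.mem_biUnion]
  have e : strip (Step.U :: m ++ [Step.D]) = Step.U :: strip m ++ [Step.D] := by simp [strip]
  constructor
  · rintro ⟨d, hd, hm⟩
    rw [mem_dyckInner h hh] at hd
    obtain ⟨h1, h2, h3⟩ := hd
    obtain ⟨rfl, h4⟩ := (mem_sh d i h1 m).1 hm
    rw [← e, sch_strip] at h2
    rw [countU_strip] at h3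
    exact ⟨h2, h3, h4⟩
  · rintro ⟨h1, h2, h3⟩
    have h0 : Step.H ∉ strip m := by simp [strip]
    refine ⟨strip m, ?_, (mem_sh _ i h0 m).2 ⟨rfl, h3⟩⟩
    rw [mem_dyckInner h hh, ← e, sch_strip, countU_strip]
    exact ⟨h0, h1, h2⟩

lemma card_mid (h i : ℕ) (hh : 1 ≤ h) : (mid h i).card = multichoose (2 * h - 1) i * catalan h := by
  rw [mid, Finset.card_biUnion]
  · rw [Finset.sum_congr rfl (g := fun _ => multichoose (2 * h - 1) i)]
    · rw [Finset.sum_const, card_dyckInner h hh, smul_eq_mul, mul_comm]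
    · intro d hd
      rw [card_sh d i ((mem_dyckInner h hh d).1 hd).1, length_inner h hh d hd, multichoose]
      congr 1
      omega
  · intro d hd d' hd' hne
    change Disjoint (sh d i) (sh d' i)
    rw [Finset.disjoint_left]
    intro a ha hb
    rw [mem_sh _ _ ((mem_dyckInner h hh _).1 hd).1] at ha
    rw [mem_sh _ _ ((mem_dyckInner h hh _).1 hd').1] at hb
    exact hne (ha.1.symm.trans hb.1)

lemma left_cancel (x y : Step) (hx : x ≠ Step.H) (hy : y ≠ Step.H) (a b : ℕ) (r s : List Step)
    (h : List.replicate a Step.H ++ x :: r = List.replicate b Step.H ++ y :: s) :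
    a = b ∧ r = s := by
  induction a generalizing b with
  | zero =>
    cases b with
    | zero => simp at h; exact ⟨rfl, h.2⟩
    | succ b => simp [List.replicate_succ] at h; exact absurd h.1 hx
  | succ a ih =>
    cases b with
    | zero => simp [List.replicate_succ] at h; exact absurd h.1.symm hy
    | succ b =>
      simp only [List.replicate_succ, List.cons_append, List.cons.injEq, true_and] at h
      have := ih b h
      exact ⟨by omega, this.2⟩

lemma right_cancel (a b : ℕ) (r s : List Step)
    (h : r ++ Step.D :: List.replicate a Step.H = s ++ Step.D :: List.replicate b Step.H) :
    r = s := by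
  have := congrArg List.reverse h
  simp only [List.reverse_append, List.reverse_cons, List.reverse_replicate, List.append_assoc,
    List.singleton_append] at this
  exact List.reverse_injective (left_cancel _ _ (by decide) (by decide) _ _ _ _ this).2

lemma sub_left (x : Step) (hx : x ≠ Step.H) (a : ℕ) (p r : List Step) :
    (x :: p).Sublist (List.replicate a Step.H ++ x :: r) ↔ p.Sublist r := by
  induction a with
  | zero => simp
  | succ a ih =>
    rw [← ih, List.replicate_succ, List.cons_append]
    constructor
    · intro h
      cases h with
      | cons _ h => exact h
      | cons_cons _ h => exact absurd rfl hx
    · intro h; exact h.cons _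

lemma sub_right (b : ℕ) (p r : List Step) :
    (p ++ [Step.D]).Sublist (r ++ Step.D :: List.replicate b Step.H) ↔ p.Sublist r := by
  rw [← List.reverse_sublist]
  simp only [List.reverse_append, List.reverse_cons, List.reverse_replicate, List.append_assoc,
    List.singleton_append, List.reverse_nil, List.nil_append]
  rw [sub_left _ (by decide), List.reverse_sublist]

/-- Assembling a word. -/
def word (a : ℕ) (m : List Step) (b : ℕ) : List Step :=
  List.replicate a Step.H ++ Step.U :: (m ++ Step.D :: List.replicate b Step.H)

lemma word_inj (a a' b b' : ℕ) (m m') (h : word a m b = word a' m' b') : a = a' ∧ m = m' := by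
  obtain ⟨h1, h2⟩ := left_cancel _ _ (by decide) (by decide) _ _ _ _ h
  exact ⟨h1, right_cancel _ _ _ _ h2⟩

lemma word_pattern (a b j : ℕ) (m) :
    ([Step.U] ++ List.replicate j Step.H ++ [Step.D]).Sublist (word a m b) ↔ j ≤ countH m := by
  rw [word, List.append_assoc, List.singleton_append, sub_left _ (by decide), sub_right,
    List.replicate_sublist_iff, countH]

lemma word_sch (a b : ℕ) (m) : IsSchroder (word a m b) ↔ IsSchroder (Step.U :: m ++ [Step.D]) := by
  rw [← sch_strip, ← sch_strip (Step.U :: m ++ [Step.D])]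
  have : strip (word a m b) = strip (Step.U :: m ++ [Step.D]) := by simp [strip, word]
  rw [this]

lemma word_semilength (a b : ℕ) (m) :
    semilength (word a m b) = countU m + 1 + countH m + a + b := by
  simp [semilength, word, countU, countH, List.count_replicate]
  omega

lemma decomp (w : List Step) : (w = List.replicate w.length Step.H) ∨
    ∃ a x r, x ≠ Step.H ∧ w = List.replicate a Step.H ++ x :: r := by
  induction w with
  | nil => left; rfl
  | cons y w ih =>
    by_cases hy : y = Step.H
    · subst hy
      rcases ih with h | ⟨a, x, r, hx, h⟩
      · left
        rw [List.length_cons, List.replicate_succ, ← h]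
      · right
        exact ⟨a + 1, x, r, hx, by rw [h]; rfl⟩
    · right
      exact ⟨0, y, w, hy, rfl⟩

lemma sch_decomp (w : List Step) (hw : IsSchroder w) :
    (w = List.replicate w.length Step.H) ∨ ∃ a m b, w = word a m b := by
  rcases decomp w with h | ⟨a, x, r, hx, h⟩
  · exact Or.inl h
  right
  obtain ⟨hp, hc⟩ := hw
  cases x with
  | H => exact absurd rfl hx
  | D =>
    exfalso
    have := hp (List.replicate a Step.H ++ [Step.D]) ⟨r, by rw [h]; simp⟩
    simp [countU, countD, List.count_replicate] at this
  | U =>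
    rcases decomp r.reverse with h' | ⟨b, y, s, hy, h'⟩
    · exfalso
      rw [List.reverse_eq_iff] at h'
      rw [h, h'] at hc
      simp [countU, countD, List.count_replicate] at hc
    · rw [List.reverse_eq_iff] at h'
      simp only [List.reverse_append, List.reverse_cons, List.reverse_replicate, List.append_assoc,
        List.singleton_append] at h'
      cases y with
      | H => exact absurd rfl hy
      | U =>
        exfalso
        have := hp (List.replicate a Step.H ++ Step.U :: s.reverse)
          ⟨Step.U :: List.replicate b Step.H, by rw [h, h']; simp⟩
        rw [h, h'] at hc
        simp [countU, countD, List.count_replicate] at this hc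
        omega
      | D => exact ⟨a, s.reverse, b, by rw [h, h']; rfl⟩

/-- Index set of the words containing an up step. -/
noncomputable def idx (n k : ℕ) : Finset (Σ _ : ℕ, Σ _ : ℕ, List Step × ℕ) :=
  (Finset.Icc 1 n).sigma fun h => (Finset.range (min (k - 2) (n - h) + 1)).sigma fun i =>
    mid h i ×ˢ Finset.range (n - h - i + 1)

/-- The word of an index. -/
def toWord (n : ℕ) (t : Σ _ : ℕ, Σ _ : ℕ, List Step × ℕ) : List Step :=
  word t.2.2.2 t.2.2.1 (n - t.1 - t.2.1 - t.2.2.2)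

lemma mem_idx (n k h i : ℕ) (m : List Step) (a : ℕ) : (⟨h, i, m, a⟩ : Σ _ : ℕ, Σ _ : ℕ, List Step × ℕ) ∈ idx n k ↔
    IsSchroder (Step.U :: m ++ [Step.D]) ∧ countU m + 1 = h ∧ countH m = i ∧ i ≤ k - 2 ∧
      h + i + a ≤ n := by
  simp only [idx, Finset.mem_sigma, Finset.mem_Icc, Finset.mem_range, Finset.mem_product]
  constructor
  · rintro ⟨⟨h1, h2⟩, h3, h4, h5⟩
    rw [mem_mid h i h1] at h4
    exact ⟨h4.1, h4.2.1, h4.2.2, by omega, by omega⟩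
  · rintro ⟨h1, h2, h3, h4, h5⟩
    rw [mem_mid h i (by omega)]
    exact ⟨by omega, by omega, ⟨h1, h2, h3⟩, by omega⟩

lemma card_idx (n k : ℕ) : (idx n k).card =
    ∑ h ∈ Finset.Icc 1 n, ∑ i ∈ Finset.range (min (k - 2) (n - h) + 1),
        multichoose (2 * h - 1) i * (n - h - i + 1) * catalan h := by
  rw [idx, Finset.card_sigma]
  refine Finset.sum_congr rfl fun h hh => ?_
  rw [Finset.card_sigma]
  refine Finset.sum_congr rfl fun i _ => ?_
  rw [Finset.card_product, card_mid h i (Finset.mem_Icc.1 hh).1, Finset.card_range]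
  ring

lemma toWord_injOn (n k : ℕ) : Set.InjOn (toWord n) (idx n k : Set _) := by
  rintro ⟨h, i, m, a⟩ h1 ⟨h', i', m', a'⟩ h2 he
  rw [Finset.mem_coe, mem_idx] at h1 h2
  obtain ⟨e1, e2⟩ := word_inj _ _ _ _ _ _ he
  simp only at e1 e2
  subst e1 e2
  obtain ⟨-, rfl, rfl, -⟩ := h1
  obtain ⟨-, rfl, rfl, -⟩ := h2
  rfl

lemma set_eq (n k : ℕ) (hk : 2 ≤ k) :
    {w : List Step | IsSchroder w ∧ semilength w = n ∧
      ¬ ([Step.U] ++ List.replicate (k - 1) Step.H ++ [Step.D]).Sublist w} =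
    (insert (List.replicate n Step.H) ((idx n k).image (toWord n)) : Finset (List Step)) := by
  ext w
  simp only [Set.mem_ofPred_eq, Finset.coe_insert, Finset.coe_image, Set.mem_insert_iff,
    Set.mem_image, Finset.mem_coe]
  constructor
  · rintro ⟨h1, h2, h3⟩
    rcases sch_decomp w h1 with h | ⟨a, m, b, rfl⟩
    · left
      rw [h] at h2
      simp [semilength, countU, countH, List.count_replicate] at h2
      rw [h, h2]
    · right
      rw [word_sch] at h1
      rw [word_semilength] at h2
      rw [word_pattern] at h3
      refine ⟨⟨countU m + 1, countH m, m, a⟩, ?_, ?_⟩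
      · rw [mem_idx]
        exact ⟨h1, rfl, rfl, by omega, by omega⟩
      · simp only [toWord]
        congr 1
        omega
  · rintro (rfl | ⟨⟨h, i, m, a⟩, h1, rfl⟩)
    · refine ⟨?_, ?_, ?_⟩
      · rw [← sch_strip]
        have : strip (List.replicate n Step.H) = [] := by simp [strip]
        rw [this]
        refine ⟨fun p hp => ?_, rfl⟩
        rw [List.prefix_nil.1 hp]; rfl
      · simp [semilength, countU, countH, List.count_replicate]
      · intro h
        have : Step.U ∈ List.replicate n Step.H := h.subset (by simp)
        simp at this
    · rw [mem_idx] at h1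
      obtain ⟨h1, h2, h3, h4, h5⟩ := h1
      simp only [toWord]
      rw [word_sch, word_semilength, word_pattern]
      exact ⟨h1, by omega, by omega⟩

end SchroderAux

theorem schroder_avoid_UHkD (n k : ℕ) (hk : 2 ≤ k) :
    schroderAvoidCount n ([Step.U] ++ List.replicate (k - 1) Step.H ++ [Step.D]) =
      1 + ∑ h ∈ Finset.Icc 1 n, ∑ i ∈ Finset.range (min (k - 2) (n - h) + 1),
        multichoose (2 * h - 1) i * (n - h - i + 1) * catalan h := by
  have h1 : schroderAvoidCount n ([Step.U] ++ List.replicate (k - 1) Step.H ++ [Step.D]) =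
      Set.ncard {w : List Step | IsSchroder w ∧ semilength w = n ∧
        ¬ ([Step.U] ++ List.replicate (k - 1) Step.H ++ [Step.D]).Sublist w} := rfl
  rw [h1, SchroderAux.set_eq n k hk, Set.ncard_coe_finset, Finset.card_insert_of_notMem,
    Finset.card_image_of_injOn (SchroderAux.toWord_injOn n k), SchroderAux.card_idx, add_comm]
  intro h
  obtain ⟨t, -, ht⟩ := Finset.mem_image.1 h
  have : Step.U ∈ SchroderAux.toWord n t := by simp [SchroderAux.toWord, SchroderAux.word]
  rw [ht] at this
  simp at this
end

section
/- For every n ≥ 0, the number of Schröder words of semilength n avoiding the pattern UHD equals 1 + Σ_{h=1}^{n} (n−h+1) · C_h, where C_h denotes the h-th Catalan number. -/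
namespace SchroderUHD

/-- Embedding of Dyck steps. -/
def emb : DyckStep → Step
  | DyckStep.U => Step.U
  | DyckStep.D => Step.D

/-- Forget horizontal steps. -/
def toDyck : Step → Option DyckStep
  | Step.U => some DyckStep.U
  | Step.D => some DyckStep.D
  | Step.H => none

/-- Forget all horizontal steps of a word. -/
def strip (w : List Step) : List DyckStep := w.filterMap toDyck

lemma count_U_strip (w : List Step) : (strip w).count DyckStep.U = countU w := by
  induction w with
  | nil => rfl
  | cons x w ih => cases x <;> simp_all [strip, countU, toDyck, List.filterMap_cons]

lemma count_D_strip (w : List Step) : (strip w).count DyckStep.D = countD w := by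
  induction w with
  | nil => rfl
  | cons x w ih => cases x <;> simp_all [strip, countD, toDyck, List.filterMap_cons]

lemma strip_append (v w : List Step) : strip (v ++ w) = strip v ++ strip w := by
  simp [strip]

lemma strip_replicate (a : ℕ) : strip (List.replicate a Step.H) = [] := by
  simp [strip, toDyck]

lemma strip_emb (l : List DyckStep) : strip (l.map emb) = l := by
  induction l with
  | nil => rfl
  | cons x w ih => cases x <;> simp_all [strip, toDyck, emb]

/-- the canonical word -/
def word (a : ℕ) (l : List DyckStep) (b : ℕ) : List Step :=
  List.replicate a Step.H ++ (l.map emb ++ List.replicate b Step.H)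

lemma strip_word (a : ℕ) (l : List DyckStep) (b : ℕ) : strip (word a l b) = l := by
  simp [word, strip_append, strip_replicate, strip_emb]

lemma countH_emb (l : List DyckStep) : (l.map emb).count Step.H = 0 := by
  induction l with
  | nil => rfl
  | cons x w ih => cases x <;> simp_all [emb]

lemma semilength_word (a : ℕ) (l : List DyckStep) (b : ℕ) :
    semilength (word a l b) = l.count DyckStep.U + (a + b) := by
  rw [semilength, ← count_U_strip, strip_word]
  simp [countH, word, countH_emb]

lemma not_HD (l : List DyckStep) (b : ℕ) :
    ¬ [Step.H, Step.D].Sublist (l.map emb ++ List.replicate b Step.H) := by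
  induction l with
  | nil =>
    intro h
    have := h.subset (show Step.D ∈ [Step.H, Step.D] by simp)
    simp at this
  | cons x l ih =>
    intro h
    rcases x with _ | _ <;> simp only [List.map_cons, List.cons_append, emb] at h <;>
    · cases h with
      | cons _ h => exact ih h

lemma avoid_word (a : ℕ) (l : List DyckStep) (b : ℕ) :
    ¬ [Step.U, Step.H, Step.D].Sublist (word a l b) := by
  induction a with
  | zero =>
    intro h
    simp only [word, List.replicate_zero, List.nil_append] at h
    exact not_HD l b ((List.sublist_cons_self _ _).trans h)
  | succ a ih =>
    intro h
    simp only [word, List.replicate_succ, List.cons_append] at h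
    cases h with
    | cons _ h => exact ih h

lemma isSchroder_of_dyck (p : DyckWord) (w : List Step) (h : strip w = p.toList) :
    IsSchroder w := by
  constructor
  · intro q hq
    obtain ⟨r, rfl⟩ := hq
    rw [strip_append] at h
    have := p.count_D_le_count_U (strip q).length
    rw [← h] at this
    simpa [count_U_strip, count_D_strip] using this
  · rw [← count_U_strip, ← count_D_strip, h, p.count_U_eq_count_D]

/-- the Dyck word underlying a Schröder word -/
def dyckOf (w : List Step) (h : IsSchroder w) : DyckWord where
  toList := strip w
  count_U_eq_count_D := by rw [count_U_strip, count_D_strip, h.2]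
  count_D_le_count_U i := by
    have h1 : strip w = (strip w).take i ++ (strip w).drop i := (List.take_append_drop ..).symm
    obtain ⟨u, v, hw, hu, hv⟩ := List.filterMap_eq_append_iff.1 h1
    rw [← hu]
    change (strip u).count _ ≤ (strip u).count _
    rw [count_U_strip, count_D_strip]
    exact h.1 u ⟨v, hw.symm⟩

lemma struct1 (r : List Step) (hQ : ∀ s, s <:+ r → countU s ≤ countD s)
    (hr : ¬ [Step.H, Step.D].Sublist r) :
    ∃ l b, r = word 0 l b := by
  induction r with
  | nil => exact ⟨[], 0, rfl⟩
  | cons x r ih =>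
    have ih' := ih (fun s hs => hQ s (hs.trans (List.suffix_cons _ _)))
      (fun h => hr (h.trans (List.sublist_cons_self _ _)))
    obtain ⟨l, b, hlb⟩ := ih'
    cases x with
    | U => exact ⟨DyckStep.U :: l, b, by simp [hlb, word, emb]⟩
    | D => exact ⟨DyckStep.D :: l, b, by simp [hlb, word, emb]⟩
    | H =>
      have hD : Step.D ∉ r := fun h => hr (by simpa using h)
      have hD' : countD r = 0 := List.count_eq_zero.2 hD
      have hU' : countU r = 0 := by
        have := hQ r (List.suffix_cons _ _)
        omega
      have hU : Step.U ∉ r := List.count_eq_zero.1 hU'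
      refine ⟨[], r.length + 1, ?_⟩
      have : r = List.replicate r.length Step.H := by
        rw [List.eq_replicate_iff]
        refine ⟨rfl, fun y hy => ?_⟩
        cases y <;> first | rfl | exact absurd hy ‹_›
      simp only [word, List.replicate_succ, List.replicate_zero, List.nil_append, List.map_nil]
      rw [← this]

lemma struct2 (w : List Step) (hQ : ∀ s, s <:+ w → countU s ≤ countD s)
    (hw : ¬ [Step.U, Step.H, Step.D].Sublist w) (hh : (strip w).head? ≠ some DyckStep.D) :
    ∃ a l b, w = word a l b := by
  induction w with
  | nil => exact ⟨0, [], 0, rfl⟩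
  | cons x r ih =>
    have hQ' := (fun s (hs : s <:+ r) => hQ s (hs.trans (List.suffix_cons x r)))
    cases x with
    | D => simp [strip, toDyck] at hh
    | U =>
      obtain ⟨l, b, h⟩ := struct1 r hQ' (fun h => hw (h.cons_cons _))
      exact ⟨0, DyckStep.U :: l, b, by simp [h, word, emb]⟩
    | H =>
      obtain ⟨a, l, b, h⟩ := ih hQ' (fun h => hw (h.trans (List.sublist_cons_self _ _)))
        hh
      exact ⟨a + 1, l, b, by simp [h, word, List.replicate_succ]⟩

lemma struct (w : List Step) (h : IsSchroder w) (hw : ¬ [Step.U, Step.H, Step.D].Sublist w) :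
    ∃ a b, w = word a (dyckOf w h).toList b := by
  obtain ⟨a, l, b, hl⟩ := struct2 w (by
    rintro s ⟨q, rfl⟩
    have h1 := h.1 q ⟨s, rfl⟩
    have h2 := h.2
    simp only [countU, countD, List.count_append] at *
    omega) hw (by
    intro hh
    have h0 := (dyckOf w h).count_D_le_count_U 1
    change ((strip w).take 1).count _ ≤ ((strip w).take 1).count _ at h0
    cases hs : strip w with
    | nil => simp [hs] at hh
    | cons y t =>
      rw [hs] at h0 hh
      simp at hh
      subst hh
      simp at h0)
  refine ⟨a, b, ?_⟩
  have : (dyckOf w h).toList = l := by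
    change strip w = l
    rw [hl, strip_word]
  rw [this, hl]

lemma rep_inj (a a' : ℕ) (x y : List Step)
    (h : List.replicate a Step.H ++ Step.U :: x = List.replicate a' Step.H ++ Step.U :: y) :
    a = a' := by
  induction a generalizing a' with
  | zero => cases a' <;> simp_all [List.replicate_succ]
  | succ a ih =>
    cases a' with
    | zero => simp [List.replicate_succ] at h
    | succ a' =>
      simp only [List.replicate_succ, List.cons_append, List.cons.injEq, true_and] at h
      rw [ih a' h]

lemma word_inj (p : DyckWord) (hp : p ≠ 0) (a b a' b' : ℕ)
    (h : word a p.toList b = word a' p.toList b') : a = a' := by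
  have hne := DyckWord.toList_ne_nil.2 hp
  have h1 := p.head_eq_U hne
  cases hl : p.toList with
  | nil => exact absurd hl hne
  | cons y t =>
    have : y = DyckStep.U := by simpa [hl] using h1
    subst this
    rw [hl] at h
    simp only [word, List.map_cons, emb, List.cons_append] at h
    exact rep_inj _ _ _ _ h

/-- index type -/
abbrev Idx (n : ℕ) : Type :=
  Unit ⊕ (Σ h : Finset.Icc 1 n, Fin (n - h.1 + 1) × {p : DyckWord // p.semilength = h.1})

/-- underlying word of an index -/
def toWord (n : ℕ) : Idx n → List Step
  | Sum.inl _ => word 0 [] n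
  | Sum.inr ⟨h, a, p⟩ => word a p.1.toList (n - h.1 - a)

lemma toWord_mem (n : ℕ) (i : Idx n) : IsSchroder (toWord n i) ∧ semilength (toWord n i) = n ∧
    ¬ [Step.U, Step.H, Step.D].Sublist (toWord n i) := by
  rcases i with _ | ⟨⟨h, hh⟩, a, ⟨p, hp⟩⟩
  · refine ⟨isSchroder_of_dyck 0 _ (strip_word _ _ _), ?_, avoid_word _ _ _⟩
    simp [toWord, semilength_word]
  · refine ⟨isSchroder_of_dyck p _ (strip_word _ _ _), ?_, avoid_word _ _ _⟩
    have h1 := a.2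
    have h2 := (Finset.mem_Icc.1 hh)
    simp only [toWord, semilength_word]
    change p.semilength + _ = n
    simp only at hp h1
    omega

lemma toWord_inj (n : ℕ) : Function.Injective (toWord n) := by
  rintro (_ | ⟨⟨h, hh⟩, a, ⟨p, hp⟩⟩) (_ | ⟨⟨h', hh'⟩, a', ⟨p', hp'⟩⟩) e
  · rfl
  · exfalso
    have := congrArg strip e
    simp only [toWord, strip_word] at this
    have h0 := DyckWord.toList_eq_nil.1 this.symm
    subst h0
    simp at hp' hh'
    omega
  · exfalso
    have := congrArg strip e
    simp only [toWord, strip_word] at this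
    have h0 := DyckWord.toList_eq_nil.1 this
    subst h0
    simp at hp hh
    omega
  · have := congrArg strip e
    simp only [toWord, strip_word] at this
    have h0 : p = p' := DyckWord.ext this
    subst h0
    simp only at hp hp'
    subst hp
    subst hp'
    have hne : p ≠ 0 := by
      rintro rfl
      simp at hh
    have ha : a = a' := Fin.ext (word_inj p hne _ _ _ _ e)
    subst ha
    rfl

lemma toWord_surj (n : ℕ) (w : List Step) (h : IsSchroder w) (hn : semilength w = n)
    (hw : ¬ [Step.U, Step.H, Step.D].Sublist w) : ∃ i, toWord n i = w := by
  obtain ⟨a, b, e⟩ := struct w h hw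
  generalize dyckOf w h = p at e
  have hs : p.semilength + (a + b) = n := by
    rw [← hn, e, semilength_word]; rfl
  by_cases hp : p = 0
  · subst hp
    refine ⟨Sum.inl (), ?_⟩
    simp at hs
    rw [e, ← hs]
    change List.replicate 0 _ ++ ([] ++ List.replicate (a + b) _) =
      List.replicate a _ ++ ([] ++ List.replicate b _)
    simp
  · have hpos : 0 < p.semilength := by
      rw [Nat.pos_iff_ne_zero]
      intro h0
      have := p.two_mul_semilength_eq_length
      rw [h0] at this
      exact hp (DyckWord.toList_eq_nil.1 (List.length_eq_zero_iff.1 (by omega)))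
    refine ⟨Sum.inr ⟨⟨p.semilength, Finset.mem_Icc.2 ⟨hpos, by omega⟩⟩,
      ⟨a, by simp only; omega⟩, ⟨p, rfl⟩⟩, ?_⟩
    simp only [toWord]
    rw [e]
    congr 1
    omega

end SchroderUHD

open SchroderUHD in
theorem schroder_avoid_UHD (n : ℕ) :
    schroderAvoidCount n [Step.U, Step.H, Step.D] =
      1 + ∑ h ∈ Finset.Icc 1 n, (n - h + 1) * catalan h := by
  have key : Nat.card (Idx n) = schroderAvoidCount n [Step.U, Step.H, Step.D] := by
    apply Nat.card_congr
    refine Equiv.ofBijective (fun i => ⟨toWord n i, toWord_mem n i⟩) ⟨?_, ?_⟩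
    · intro i j hij
      exact toWord_inj n (congrArg Subtype.val hij)
    · rintro ⟨w, h1, h2, h3⟩
      obtain ⟨i, hi⟩ := toWord_surj n w h1 h2 h3
      exact ⟨i, Subtype.ext hi⟩
  rw [← key, Nat.card_eq_fintype_card]
  simp only [Fintype.card_sum, Fintype.card_unit, Fintype.card_sigma, Fintype.card_prod,
    Fintype.card_fin, DyckWord.card_dyckWord_semilength_eq_catalan]
  congr 1
  exact Finset.sum_coe_sort (Finset.Icc 1 n) (fun h => (n - h + 1) * catalan h)
end

section
/- For all n ≥ 0 and q ≥ 0, the number S_{n,q} of Schröder words of semilength n containing exactly q H steps equals multichoose(2(n−q)+1, q) · C_{n−q} = binom(2n−q, q) · C_{n−q}, where multichoose(m, i) = binom(m+i−1, i) and C_m denotes the m-th Catalan number (and S_{n,q} = 0 when q > n). -/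
/-- `schroderHCount n q` is the number of Schröder words of semilength `n`
with exactly `q` horizontal steps. -/
noncomputable def schroderHCount (n q : ℕ) : ℕ :=
  Nat.card {w : List Step // IsSchroder w ∧ semilength w = n ∧ countH w = q}

/-- Schröder words started at height `h` and ending at height `0`. -/
def OkFrom : ℕ → List Step → Prop
  | h, [] => h = 0
  | h, Step.U :: w => OkFrom (h + 1) w
  | 0, Step.D :: _ => False
  | h + 1, Step.D :: w => OkFrom h w
  | h, Step.H :: w => OkFrom h w

theorem okFrom_iff (w : List Step) : ∀ h : ℕ, OkFrom h w ↔
    ((∀ p : List Step, p <+: w → countD p ≤ h + countU p) ∧ h + countU w = countD w) := by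
  induction w with
  | nil =>
    intro h
    simp [OkFrom, countU, countD]
  | cons a w ih =>
    intro h
    have key : (∀ p : List Step, p <+: a :: w → countD p ≤ h + countU p) ↔
        ∀ p : List Step, p <+: w → countD (a :: p) ≤ h + countU (a :: p) := by
      constructor
      · intro H p hp
        exact H _ (by simpa using hp)
      · intro H p hp
        cases p with
        | nil => simp [countD]
        | cons b p =>
          rw [List.cons_prefix_cons] at hp
          obtain ⟨rfl, hp⟩ := hp
          exact H p hp
    rw [key]
    cases a with
    | U =>
      simp only [OkFrom, ih]
      simp [countU, countD, add_left_comm, add_comm]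
    | D =>
      cases h with
      | zero =>
        simp only [OkFrom, false_iff]
        rintro ⟨H, -⟩
        have := H [] (by simp)
        simp [countU, countD] at this
      | succ h =>
        simp only [OkFrom, ih]
        simp only [countU, countD, List.count_cons]
        simp
        grind
    | H =>
      simp only [OkFrom, ih]
      simp [countU, countD]

/-- Words of length `l` from height `h` to `0` with `q` horizontal steps. -/
def words : ℕ → ℕ → ℕ → Finset (List Step)
  | 0, h, q => if h = 0 ∧ q = 0 then {[]} else ∅
  | l + 1, h, q =>
    (words l (h + 1) q).map ⟨List.cons Step.U, List.cons_injective⟩ ∪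
    ((if h = 0 then ∅ else (words l (h - 1) q).map ⟨List.cons Step.D, List.cons_injective⟩) ∪
    (if q = 0 then ∅ else (words l h (q - 1)).map ⟨List.cons Step.H, List.cons_injective⟩))

theorem mem_words (l : ℕ) : ∀ (h q : ℕ) (w : List Step),
    w ∈ words l h q ↔ OkFrom h w ∧ w.length = l ∧ countH w = q := by
  induction l with
  | zero =>
    intro h q w
    cases w with
    | nil => simp only [words, OkFrom, countH]; split_ifs <;> simp <;> grind
    | cons a w => simp only [words]; split_ifs <;> simp
  | succ l ih =>
    intro h q w
    cases w with
    | nil => simp only [words]; split_ifs <;> simp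
    | cons a w =>
      cases a <;> cases h <;> cases q <;> simp [words, OkFrom, ih, countH]

/-- The number of `H`-free words of length `n` from height `h` to `0`. -/
def ballot : ℕ → ℕ → ℕ
  | 0, h => if h = 0 then 1 else 0
  | n + 1, 0 => ballot n 1
  | n + 1, h + 1 => ballot n (h + 2) + ballot n h

theorem card_words_succ (l h q : ℕ) : (words (l + 1) h q).card =
    (words l (h + 1) q).card + ((if h = 0 then 0 else (words l (h - 1) q).card) +
      (if q = 0 then 0 else (words l h (q - 1)).card)) := by
  rw [words, Finset.card_union_of_disjoint, Finset.card_union_of_disjoint]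
  · split_ifs <;> simp
  · rw [Finset.disjoint_left]
    intro w
    split_ifs <;> simp
    rintro x - rfl
    simp
  · rw [Finset.disjoint_left]
    intro w
    split_ifs <;> simp <;> rintro x - rfl <;> simp

theorem card_words_lt (l : ℕ) : ∀ h q : ℕ, l < q → (words l h q).card = 0 := by
  intro h q hq
  rw [Finset.card_eq_zero, Finset.eq_empty_iff_forall_notMem]
  intro w hw
  rw [mem_words] at hw
  have := List.count_le_length (a := Step.H) (l := w)
  unfold countH at hw
  omega

theorem card_words (l : ℕ) : ∀ h q N : ℕ, l = N + q →
    (words l h q).card = Nat.choose l q * ballot N h := by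
  induction l with
  | zero =>
    intro h q N e
    obtain ⟨rfl, rfl⟩ : N = 0 ∧ q = 0 := by omega
    by_cases hh : h = 0 <;> simp [words, ballot, hh]
  | succ l ih =>
    intro h q N e
    rw [card_words_succ]
    cases N with
    | zero =>
      obtain rfl : q = l + 1 := by omega
      rw [card_words_lt l _ _ (by omega), card_words_lt l _ _ (by omega)]
      simp [ih h l 0 (by omega)]
    | succ N =>
      have hB : ballot (N + 1) h = ballot N (h + 1) + if h = 0 then 0 else ballot N (h - 1) := by
        cases h <;> simp [ballot]
      rw [ih (h + 1) q N (by omega), ih (h - 1) q N (by omega)]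
      cases q with
      | zero => rw [hB]; split_ifs <;> simp_all
      | succ q =>
        have := ih h q (N + 1) (by omega)
        simp only [Nat.add_sub_cancel, Nat.succ_ne_zero, if_false, this]
        rw [Nat.choose_succ_succ, add_mul, add_comm (Nat.choose l q * _)]
        conv_rhs => rw [hB]
        rw [hB]
        split_ifs <;> ring

theorem ballot_lt (n : ℕ) : ∀ h, n < h → ballot n h = 0 := by
  induction n with
  | zero => intro h hh; simp [ballot]; omega
  | succ n ih =>
    intro h hh
    cases h with
    | zero => omega
    | succ h => simp [ballot, ih (h + 2) (by omega), ih h (by omega)]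

theorem ballot_formula (n : ℕ) : ∀ u h : ℕ, n = 2 * u + h →
    ballot n h + Nat.choose n (u + h + 1) = Nat.choose n (u + h) := by
  induction n with
  | zero =>
    intro u h e
    obtain ⟨rfl, rfl⟩ : u = 0 ∧ h = 0 := by omega
    simp [ballot]
  | succ n ih =>
    intro u h e
    cases h with
    | zero =>
      obtain ⟨v, rfl⟩ : ∃ v, u = v + 1 := ⟨u - 1, by omega⟩
      have h1 := ih v 1 (by omega)
      have h2 : Nat.choose n v = Nat.choose n (v + 1) :=
        Nat.choose_symm_of_eq_add (by omega)
      simp only [ballot, add_zero, Nat.choose_succ_succ'] at *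
      omega
    | succ h =>
      have h1 := ih u h (by omega)
      have h2 : ballot n (h + 2) + Nat.choose n (u + h + 2) = Nat.choose n (u + h + 1) := by
        cases u with
        | zero =>
          rw [ballot_lt _ _ (by omega), Nat.choose_eq_zero_of_lt (by omega),
            Nat.choose_eq_zero_of_lt (by omega)]
        | succ u =>
          have := ih u (h + 2) (by omega)
          rw [show u + 1 + h + 2 = u + (h + 2) + 1 by ring,
            show u + 1 + h + 1 = u + (h + 2) by ring]
          exact this
      rw [ballot, show u + (h + 1) + 1 = (u + h + 1) + 1 by ring,
        show u + (h + 1) = (u + h) + 1 by ring, Nat.choose_succ_succ', Nat.choose_succ_succ']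
      simp only [add_assoc, Nat.reduceAdd] at *
      omega

theorem ballot_catalan (m : ℕ) : ballot (2 * m) 0 = catalan m := by
  have h1 := ballot_formula (2 * m) m 0 (by omega)
  have h2 := succ_mul_catalan_eq_centralBinom m
  have h3 := Nat.choose_succ_right_eq (2 * m) m
  rw [Nat.centralBinom] at h2
  rw [show 2 * m - m = m by omega] at h3
  simp only [add_zero] at h1
  apply Nat.eq_of_mul_eq_mul_left (Nat.succ_pos m)
  rw [Nat.succ_eq_add_one, h2]
  nlinarith

theorem schroderHCount_eq (n q : ℕ) (hq : q ≤ n) :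
    schroderHCount n q = Nat.choose (2 * n - q) q * catalan (n - q) := by
  rw [← ballot_catalan, ← card_words (2 * n - q) 0 q (2 * (n - q)) (by omega)]
  rw [schroderHCount]
  apply Nat.subtype_card
  intro w
  rw [mem_words, okFrom_iff, length_eq_counts]
  simp only [IsSchroder, semilength, zero_add]
  constructor
  · rintro ⟨⟨h1, h2⟩, h3, h4⟩
    exact ⟨⟨h1, h2⟩, by omega, h4⟩
  · rintro ⟨⟨h1, h2⟩, h3, h4⟩
    exact ⟨⟨h1, h2⟩, by omega, h4⟩

theorem schroder_count_by_H (n q : ℕ) :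
    (q ≤ n →
      schroderHCount n q = multichoose (2 * (n - q) + 1) q * catalan (n - q) ∧
      schroderHCount n q = Nat.choose (2 * n - q) q * catalan (n - q)) ∧
    (n < q → schroderHCount n q = 0) := by
  refine ⟨fun hq => ?_, fun hq => ?_⟩
  · refine ⟨?_, schroderHCount_eq n q hq⟩
    rw [schroderHCount_eq n q hq, multichoose,
      show 2 * (n - q) + 1 + q - 1 = 2 * n - q by omega]
  · rw [schroderHCount, Nat.card_eq_zero]
    left
    constructor
    rintro ⟨w, -, h1, h2⟩
    unfold semilength at h1
    omega
end
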